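/- Fix an integer λ ≥ 1. For every irrational x ∈ (0,1) and every j ≥ 0 with a_{j+1} > λ, the λ-th mediant m_j := (λ p_j + p_{j−1})/(λ q_j + q_{j−1}) satisfies λ/(λ+1) < Θ(x, m_j) < λ + 1. Moreover, for Lebesgue-almost every irrational x ∈ (0,1) the set J := {j ≥ 0 : a_{j+1} > λ} is infinite and, enumerating J increasingly as j_0 < j_1 < ⋯ and setting C := log((λ+2)/(λ+1)), for every z ∈ [λ/(λ+1), λ+1] the limit lim_{n→∞} (1/n) · #{0 ≤ k < n : Θ(x, m_{j_k}) ≤ z} exists and equals: (1/C)·((λ+1)z/λ − 1 + log(λ/((λ+1)z))) for λ/(λ+1) ≤ z ≤ (λ+1)/(λ+2); (1/C)·(z/(λ(λ+1)) + log(λ(λ+2)/(λ+1)²)) for (λ+1)/(λ+2) ≤ z ≤ λ; (1/C)·(1 − z/(λ+1) + log((λ+2)z/(λ+1)²)) for λ ≤ z ≤ λ+1. -/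

import Mathlib

open MeasureTheory Filter Topology
open scoped Classical

noncomputable section

/-- The Farey tent map `F`. -/
def fareyMap (x : ℝ) : ℝ := if x ≤ 1/2 then x / (1 - x) else (1 - x) / x

/-- `eps x n = ε_{n+1}(x)`, i.e. `0` if `F^[n] x ≤ 1/2` and `1` otherwise. -/
def eps (x : ℝ) (n : ℕ) : ℤ := if fareyMap^[n] x ≤ 1/2 then 0 else 1

/-- The matrices `A_0 = [[1,0],[1,1]]` and `A_1 = [[0,1],[1,1]]`. -/
def Amat (e : ℤ) : Matrix (Fin 2) (Fin 2) ℤ := !![1 - e, e; 1, 1]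

/-- `Mmat x n = A_{ε_1(x)} ⋯ A_{ε_n(x)}`, with `Mmat x 0` the identity. -/
def Mmat (x : ℝ) : ℕ → Matrix (Fin 2) (Fin 2) ℤ
  | 0 => 1
  | n + 1 => Mmat x n * Amat (eps x n)

/-- `u_n(x)`: top-left entry of `M_n(x)`. -/
def uF (x : ℝ) (n : ℕ) : ℤ := Mmat x n 0 0

/-- `s_n(x)`: bottom-left entry of `M_n(x)`. -/
def sF (x : ℝ) (n : ℕ) : ℤ := Mmat x n 1 0

/-- Ito's natural extension `F̄` of the Farey tent map. -/
def fareyNE (p : ℝ × ℝ) : ℝ × ℝ :=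
  if p.1 ≤ 1/2 then (p.1 / (1 - p.1), p.2 / (1 + p.2))
  else ((1 - p.1) / p.1, 1 / (1 + p.2))

/-- `Ω = [0,1]²`. -/
def OmegaSet : Set (ℝ × ℝ) := Set.Icc (0:ℝ) 1 ×ˢ Set.Icc (0:ℝ) 1

/-- The measure `μ̄` on `Ω` with density `(x + y − xy)⁻²` w.r.t. Lebesgue measure. -/
def muBar : Measure (ℝ × ℝ) :=
  (volume.restrict OmegaSet).withDensity
    (fun p => ENNReal.ofReal (1 / (p.1 + p.2 - p.1 * p.2) ^ 2))

/-- A proper inducible subregion of `Ω`. -/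
def ProperInducible (R : Set (ℝ × ℝ)) : Prop :=
  R ⊆ OmegaSet ∧ MeasurableSet R ∧ 0 < muBar R ∧ muBar R < ⊤ ∧ muBar (frontier R) = 0

/-- `hitsR R x k` holds iff `k ≥ 1` and `F̄^[k] (x,1) ∈ R`. -/
def hitsR (R : Set (ℝ × ℝ)) (x : ℝ) (k : ℕ) : Prop := 1 ≤ k ∧ fareyNE^[k] (x, 1) ∈ R

/-- `Nidx R x n = N_n`: `N_0 = 0` and, for `n ≥ 1`, the `n`-th smallest `k ≥ 1`
with `F̄^[k] (x,1) ∈ R`. -/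
def Nidx (R : Set (ℝ × ℝ)) (x : ℝ) : ℕ → ℕ
  | 0 => 0
  | n + 1 => Nat.nth (hitsR R x) n

/-- `h(x,y) = (1−y)/(x + y − xy)`. -/
def hIto (p : ℝ × ℝ) : ℝ := (1 - p.2) / (p.1 + p.2 - p.1 * p.2)

/-- `Θ_n(x) = s_n(x)·|s_n(x)·x − u_n(x)|`, the approximation coefficient of the
`n`-th Farey convergent `u_n(x)/s_n(x)`. -/
def ThetaF (x : ℝ) (n : ℕ) : ℝ := (sF x n : ℝ) * |(sF x n : ℝ) * x - (uF x n : ℝ)|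

/-- `Θ_n^R(x) = s_n^R·|s_n^R·x − u_n^R|` where `u_n^R = u_{N_n}(x)`, `s_n^R = s_{N_n}(x)`. -/
def ThetaR (R : Set (ℝ × ℝ)) (x : ℝ) (n : ℕ) : ℝ := ThetaF x (Nidx R x n)

/-- The Gauss map. -/
def gaussMap (x : ℝ) : ℝ := Int.fract (1 / x)

/-- `pquot x n` is the RCF partial quotient `a_{n+1}(x)`. -/
def pquot (x : ℝ) (n : ℕ) : ℤ := ⌊1 / (gaussMap^[n] x)⌋

/-- `pnum x (j+1)` is the RCF numerator `p_j(x)`; `pnum x 0 = p_{-1} = 1`. -/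
def pnum (x : ℝ) : ℕ → ℤ
  | 0 => 1
  | 1 => 0
  | n + 2 => pquot x n * pnum x (n + 1) + pnum x n

/-- `qden x (j+1)` is the RCF denominator `q_j(x)`; `qden x 0 = q_{-1} = 0`. -/
def qden (x : ℝ) : ℕ → ℤ
  | 0 => 0
  | 1 => 1
  | n + 2 => pquot x n * qden x (n + 1) + qden x n

/-- The approximation coefficient `Θ(x, p/q) = q·|q·x − p|`. -/
def Theta (x : ℝ) (p q : ℤ) : ℝ := (q : ℝ) * |(q : ℝ) * x - (p : ℝ)|

/-- `medTheta x l j = Θ(x, (l·p_j + p_{j−1})/(l·q_j + q_{j−1}))`. -/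
def medTheta (x : ℝ) (l : ℤ) (j : ℕ) : ℝ :=
  Theta x (l * pnum x (j + 1) + pnum x j) (l * qden x (j + 1) + qden x j)

end

/-- The limiting distribution function for the `λ`-th mediant convergents,
with normalising constant `C = log((λ+2)/(λ+1))`. -/
noncomputable def dist7 (l : ℕ) (z : ℝ) : ℝ :=
  (1 / Real.log (((l:ℝ) + 2) / ((l:ℝ) + 1))) *
    (if z ≤ ((l:ℝ) + 1) / ((l:ℝ) + 2) then
        ((l:ℝ) + 1) * z / (l:ℝ) - 1 + Real.log ((l:ℝ) / (((l:ℝ) + 1) * z))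
      else if z ≤ (l:ℝ) then
        z / ((l:ℝ) * ((l:ℝ) + 1)) + Real.log ((l:ℝ) * ((l:ℝ) + 2) / (((l:ℝ) + 1) ^ 2))
      else
        1 - z / ((l:ℝ) + 1) + Real.log (((l:ℝ) + 2) * z / (((l:ℝ) + 1) ^ 2)))


/-- The inverse branches `s ↦ 1 / (k + 1 + s)` of the Gauss map. -/
noncomputable def gaussBranch (k : ℕ) (s : ℝ) : ℝ := 1 / ((k : ℝ) + 1 + s)

lemma gaussBranch_pos (k : ℕ) {s : ℝ} (hs : 0 ≤ s) : 0 < gaussBranch k s := by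
  unfold gaussBranch; positivity

lemma gaussBranch_le_one (k : ℕ) {s : ℝ} (hs : 0 ≤ s) : gaussBranch k s ≤ 1 := by
  unfold gaussBranch
  rw [div_le_one (by positivity)]
  have : (0 : ℝ) ≤ k := k.cast_nonneg
  linarith

lemma gaussBranch_mem (k : ℕ) {s : ℝ} (hs : s ∈ Set.Icc (0 : ℝ) 1) :
    gaussBranch k s ∈ Set.Icc (0 : ℝ) 1 :=
  ⟨(gaussBranch_pos k hs.1).le, gaussBranch_le_one k hs.1⟩

lemma one_div_gaussBranch (k : ℕ) (s : ℝ) : 1 / gaussBranch k s = (k : ℝ) + 1 + s := by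
  simp [gaussBranch]

lemma floor_gaussBranch (k : ℕ) {s : ℝ} (hs : s ∈ Set.Ico (0 : ℝ) 1) :
    ⌊1 / gaussBranch k s⌋ = (k : ℤ) + 1 := by
  rw [one_div_gaussBranch, Int.floor_eq_iff]
  push_cast
  exact ⟨by linarith [hs.1], by linarith [hs.2]⟩

lemma gaussMap_gaussBranch (k : ℕ) {s : ℝ} (hs : s ∈ Set.Ico (0 : ℝ) 1) :
    gaussMap (gaussBranch k s) = s := by
  rw [gaussMap, Int.fract, floor_gaussBranch k hs, one_div_gaussBranch]
  push_cast
  ring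

lemma iUnion_gaussBranch_image :
    (⋃ k : ℕ, gaussBranch k '' Set.Ico (0 : ℝ) 1) = Set.Ioc (0 : ℝ) 1 := by
  ext t
  simp only [Set.mem_iUnion, Set.mem_image]
  constructor
  · rintro ⟨k, s, hs, rfl⟩
    exact ⟨gaussBranch_pos k hs.1, gaussBranch_le_one k hs.1⟩
  · rintro ⟨h0, h1⟩
    have h : 1 ≤ 1 / t := by rwa [le_div_iff₀ h0, one_mul]
    have hf : 1 ≤ ⌊1 / t⌋ := by rw [Int.le_floor]; exact_mod_cast h
    obtain ⟨k, hk⟩ := Int.eq_ofNat_of_zero_le (sub_nonneg.2 hf)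
    have hk' : ((⌊1 / t⌋ : ℤ) : ℝ) = (k : ℝ) + 1 := by
      have : ⌊1 / t⌋ = (k : ℤ) + 1 := by linarith
      rw [this]; push_cast; ring
    refine ⟨k, Int.fract (1 / t), ⟨Int.fract_nonneg _, Int.fract_lt_one _⟩, ?_⟩
    rw [gaussBranch, ← hk', Int.floor_add_fract, one_div_one_div]

lemma injOn_gaussBranch (k : ℕ) : Set.InjOn (gaussBranch k) (Set.Ico 0 1) := by
  intro s hs u hu h
  rw [← gaussMap_gaussBranch k hs, h, gaussMap_gaussBranch k hu]

lemma hasDerivAt_gaussBranch (k : ℕ) {s : ℝ} (hs : 0 ≤ s) :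
    HasDerivAt (gaussBranch k) (-(1 / ((k : ℝ) + 1 + s) ^ 2)) s := by
  have h : HasDerivAt (fun s : ℝ => (k : ℝ) + 1 + s) 1 s := (hasDerivAt_id s).const_add _
  have e : gaussBranch k = fun s => ((k : ℝ) + 1 + s)⁻¹ := by ext; simp [gaussBranch]
  rw [e]
  exact (h.fun_inv (by positivity)).congr_deriv (by ring)

lemma measurableSet_gaussBranch_image (k : ℕ) :
    MeasurableSet (gaussBranch k '' Set.Ico (0 : ℝ) 1) :=
  (measurableSet_Ico).image_of_continuousOn_injOn
    (fun _ hs => (hasDerivAt_gaussBranch k hs.1).continuousAt.continuousWithinAt)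
    (injOn_gaussBranch k)

/-- Change of variables along all inverse branches of the Gauss map. -/
lemma hasSum_integral_gaussBranch {g : ℝ → ℝ} (hg : IntegrableOn g (Set.Ioo 0 1)) :
    HasSum (fun k : ℕ => ∫ s in Set.Ioo (0 : ℝ) 1,
      g (gaussBranch k s) / ((k : ℝ) + 1 + s) ^ 2) (∫ t in Set.Ioo (0 : ℝ) 1, g t) := by
  have hd : Pairwise (Function.onFun Disjoint fun k : ℕ => gaussBranch k '' Set.Ico (0 : ℝ) 1) := by
    intro i j hij
    rw [Function.onFun, Set.disjoint_left]
    rintro _ ⟨s, hs, rfl⟩ ⟨u, hu, h⟩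
    apply hij
    have := floor_gaussBranch i hs
    rw [← h, floor_gaussBranch j hu] at this
    omega
  have h := hasSum_integral_iUnion (μ := volume) (f := g)
    (fun k => measurableSet_gaussBranch_image k) hd
    (by rwa [iUnion_gaussBranch_image, integrableOn_Ioc_iff_integrableOn_Ioo])
  rw [iUnion_gaussBranch_image, integral_Ioc_eq_integral_Ioo] at h
  refine h.congr_fun fun k => ?_
  rw [integral_image_eq_integral_abs_deriv_smul measurableSet_Ico
    (fun s hs => (hasDerivAt_gaussBranch k hs.1).hasDerivWithinAt) (injOn_gaussBranch k),
    integral_Ico_eq_integral_Ioo]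
  refine setIntegral_congr_fun measurableSet_Ioo fun s hs => ?_
  have : (0 : ℝ) < 1 / ((k : ℝ) + 1 + s) ^ 2 := by
    have := hs.1; positivity
  simp only [smul_eq_mul, abs_neg, abs_of_pos this]
  ring

/-- The conditional density of `Tⁿ x` given that `q_{n-1} / q_n = v`. -/
noncomputable def condDensity (v t : ℝ) : ℝ := (1 + v) / (1 + v * t) ^ 2

/-- The integral against the conditional density. -/
noncomputable def condInt (v : ℝ) (Φ : ℝ → ℝ) : ℝ :=
  ∫ t in Set.Ioo (0 : ℝ) 1, condDensity v t * Φ t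

/-- The conditional probability that the next partial quotient is `k + 1`. -/
noncomputable def digitProb (k : ℕ) (v : ℝ) : ℝ :=
  (1 + v) / (((k : ℝ) + 1 + v) * ((k : ℝ) + 2 + v))

lemma digitProb_nonneg (k : ℕ) {v : ℝ} (hv : 0 ≤ v) : 0 ≤ digitProb k v := by
  unfold digitProb; positivity

lemma digitProb_le_half (k : ℕ) {v : ℝ} (hv : 0 ≤ v) : digitProb k v ≤ 1 / 2 := by
  unfold digitProb
  have : (0 : ℝ) ≤ k := k.cast_nonneg
  rw [div_le_div_iff₀ (by positivity) (by norm_num)]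
  nlinarith [mul_nonneg this hv, sq_nonneg v, sq_nonneg (k : ℝ)]

lemma condDensity_nonneg {v : ℝ} (hv : 0 ≤ v) (t : ℝ) : 0 ≤ condDensity v t := by
  unfold condDensity; positivity

lemma condDensity_gaussBranch (k : ℕ) {v s : ℝ} (hv : 0 ≤ v) (hs : 0 ≤ s) :
    condDensity v (gaussBranch k s) / ((k : ℝ) + 1 + s) ^ 2 =
      digitProb k v * condDensity (gaussBranch k v) s := by
  unfold condDensity gaussBranch digitProb
  have : (0 : ℝ) ≤ k := k.cast_nonneg
  have h1 : (k : ℝ) + 1 + s ≠ 0 := by positivity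
  have h2 : (k : ℝ) + 1 + v ≠ 0 := by positivity
  have h3 : (k : ℝ) + 2 + v ≠ 0 := by positivity
  have h4 : (k : ℝ) + 1 + v + s ≠ 0 := by positivity
  have e1 : 1 + v * (1 / ((k : ℝ) + 1 + s)) = ((k : ℝ) + 1 + v + s) / ((k : ℝ) + 1 + s) := by
    field_simp; ring
  have e2 : 1 + 1 / ((k : ℝ) + 1 + v) * s = ((k : ℝ) + 1 + v + s) / ((k : ℝ) + 1 + v) := by
    field_simp
  rw [e1, e2]
  field_simp
  ring

lemma condDensity_le {v t : ℝ} (hv : v ∈ Set.Icc (0 : ℝ) 1) (ht : 0 ≤ t) :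
    condDensity v t ≤ 2 := by
  unfold condDensity
  have := mul_nonneg hv.1 ht
  rw [div_le_iff₀ (by positivity)]
  nlinarith [hv.2, sq_nonneg (v * t)]

lemma measurable_condDensity (v : ℝ) : Measurable (condDensity v) := by
  unfold condDensity; fun_prop

/-- `Φ` is measurable and bounded by `C` on `(0, 1)`. -/
structure BddMeas (Φ : ℝ → ℝ) (C : ℝ) : Prop where
  meas : Measurable Φ
  bound : ∀ t ∈ Set.Ioo (0 : ℝ) 1, |Φ t| ≤ C

lemma BddMeas.integrableOn {Φ : ℝ → ℝ} {C : ℝ} (h : BddMeas Φ C) :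
    IntegrableOn Φ (Set.Ioo 0 1) :=
  Measure.integrableOn_of_bounded (M := C) (by simp) h.meas.aestronglyMeasurable
    ((ae_restrict_iff' measurableSet_Ioo).2 (Eventually.of_forall fun t ht => h.bound t ht))

lemma BddMeas.condDensity_mul {Φ : ℝ → ℝ} {C v : ℝ} (h : BddMeas Φ C)
    (hv : v ∈ Set.Icc (0 : ℝ) 1) : BddMeas (fun t => condDensity v t * Φ t) (2 * C) where
  meas := (measurable_condDensity v).mul h.meas
  bound t ht := by
    rw [abs_mul, abs_of_nonneg (condDensity_nonneg hv.1 t)]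
    exact mul_le_mul (condDensity_le hv ht.1.le) (h.bound t ht) (abs_nonneg _) (by norm_num)

lemma BddMeas.integrableOn_condDensity_mul {Φ : ℝ → ℝ} {C v : ℝ} (h : BddMeas Φ C)
    (hv : v ∈ Set.Icc (0 : ℝ) 1) :
    IntegrableOn (fun t => condDensity v t * Φ t) (Set.Ioo 0 1) :=
  (h.condDensity_mul hv).integrableOn

lemma condInt_indicator_Iio {v c : ℝ} (hv : 0 ≤ v) (hc : c ∈ Set.Icc (0 : ℝ) 1) :
    condInt v ((Set.Iio c).indicator 1) = (1 + v) * c / (1 + v * c) := by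
  have e : ∀ t, condDensity v t * (Set.Iio c).indicator 1 t =
      (Set.Iio c).indicator (condDensity v) t := by
    intro t
    by_cases h : t ∈ Set.Iio c <;> simp [h]
  unfold condInt
  simp_rw [e]
  rw [setIntegral_indicator measurableSet_Iio]
  have e2 : Set.Ioo (0 : ℝ) 1 ∩ Set.Iio c = Set.Ioo 0 c := by
    rw [Set.Ioo_inter_Iio, min_eq_right hc.2]
  rw [e2, ← integral_Ioc_eq_integral_Ioo, ← intervalIntegral.integral_of_le hc.1]
  have hpos : ∀ t ∈ Set.uIcc 0 c, 0 < 1 + v * t := by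
    intro t ht
    rw [Set.uIcc_of_le hc.1] at ht
    have := mul_nonneg hv ht.1
    linarith
  rw [intervalIntegral.integral_eq_sub_of_hasDerivAt (f := fun t => (1 + v) * t / (1 + v * t))]
  · simp
  · intro t ht
    have h := hpos t ht
    have h1 : HasDerivAt (fun t : ℝ => (1 + v) * t) (1 + v) t := by
      simpa using (hasDerivAt_id t).const_mul (1 + v)
    have h2 : HasDerivAt (fun t : ℝ => 1 + v * t) v t := by
      simpa using ((hasDerivAt_id t).const_mul v).const_add 1
    refine (h1.fun_div h2 h.ne').congr_deriv ?_
    unfold condDensity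
    congr 1
    ring
  · apply ContinuousOn.intervalIntegrable
    unfold condDensity
    exact continuousOn_const.div (by fun_prop) fun t ht => pow_ne_zero _ (hpos t ht).ne'

lemma condInt_congr {v : ℝ} {Φ Ψ : ℝ → ℝ} (h : ∀ t ∈ Set.Ioo (0 : ℝ) 1, Φ t = Ψ t) :
    condInt v Φ = condInt v Ψ :=
  setIntegral_congr_fun measurableSet_Ioo fun t ht => by simp only [h t ht]

lemma condInt_const {v : ℝ} (hv : 0 ≤ v) (c : ℝ) : condInt v (fun _ => c) = c := by
  have h := condInt_indicator_Iio hv (c := 1) (by simp)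
  rw [mul_one, mul_one, div_self (by positivity)] at h
  rw [condInt_congr (Ψ := fun _ => 1)] at h
  · have e : condInt v (fun _ => c) = condInt v (fun _ => 1) * c := by
      unfold condInt
      rw [← integral_mul_const]
      simp
    rw [e, h, one_mul]
  · intro t ht
    simp [ht.2]

lemma abs_condInt_le {v C : ℝ} (hv : v ∈ Set.Icc (0 : ℝ) 1) {Φ : ℝ → ℝ}
    (hC : ∀ t ∈ Set.Ioo (0 : ℝ) 1, |Φ t| ≤ C) : |condInt v Φ| ≤ C := by
  rw [← condInt_const hv.1 C]
  unfold condInt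
  rw [← Real.norm_eq_abs]
  have hb : BddMeas (fun _ => C) |C| := ⟨measurable_const, fun _ _ => le_rfl⟩
  refine norm_integral_le_of_norm_le (hb.integrableOn_condDensity_mul hv) ?_
  refine (ae_restrict_iff' measurableSet_Ioo).2 (Eventually.of_forall fun t ht => ?_)
  rw [Real.norm_eq_abs, abs_mul, abs_of_nonneg (condDensity_nonneg hv.1 t)]
  exact mul_le_mul_of_nonneg_left (hC t ht) (condDensity_nonneg hv.1 t)

/-- The Markov property of the chain `q_{n-1} / q_n`. -/
lemma hasSum_condInt {v C : ℝ} (hv : v ∈ Set.Icc (0 : ℝ) 1) {Φ : ℝ → ℝ} (hΦ : BddMeas Φ C) :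
    HasSum (fun k : ℕ => digitProb k v *
      condInt (gaussBranch k v) (fun s => Φ (gaussBranch k s))) (condInt v Φ) := by
  have h := hasSum_integral_gaussBranch (hΦ.integrableOn_condDensity_mul hv)
  refine h.congr_fun fun k => ?_
  unfold condInt
  rw [← integral_const_mul]
  symm
  refine setIntegral_congr_fun measurableSet_Ioo fun s hs => ?_
  simp only
  rw [mul_div_right_comm, condDensity_gaussBranch k hv.1 hs.1.le]
  ring

lemma hasSum_digitProb {v : ℝ} (hv : v ∈ Set.Icc (0 : ℝ) 1) :
    HasSum (fun k : ℕ => digitProb k v) 1 := by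
  have h := hasSum_condInt hv (Φ := fun _ => 1) (C := 1) ⟨measurable_const, by simp⟩
  rw [condInt_const hv.1] at h
  refine h.congr_fun fun k => ?_
  rw [condInt_const (gaussBranch_pos k hv.1).le, mul_one]

/-- The transfer operator of the Gauss map, with respect to its invariant measure. -/
noncomputable def gaussTransfer (f : ℝ → ℝ) (v : ℝ) : ℝ :=
  ∑' k : ℕ, digitProb k v * f (gaussBranch k v)

/-- `f` is bounded by `M` and `L`-Lipschitz on `[0, 1]`. -/
structure BddLip (f : ℝ → ℝ) (M L : ℝ) : Prop where
  bound : ∀ v ∈ Set.Icc (0 : ℝ) 1, |f v| ≤ M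
  lip : ∀ v ∈ Set.Icc (0 : ℝ) 1, ∀ w ∈ Set.Icc (0 : ℝ) 1, |f v - f w| ≤ L * |v - w|

lemma BddLip.nonneg {f : ℝ → ℝ} {M L : ℝ} (hf : BddLip f M L) : 0 ≤ L := by
  have := (abs_nonneg _).trans (hf.lip 0 (by simp) 1 (by simp))
  simpa using this

lemma BddLip.continuousOn {f : ℝ → ℝ} {M L : ℝ} (hf : BddLip f M L) :
    ContinuousOn f (Set.Icc 0 1) := by
  have : LipschitzOnWith L.toNNReal f (Set.Icc 0 1) := by
    refine LipschitzOnWith.of_dist_le_mul fun v hv w hw => ?_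
    rw [Real.dist_eq, Real.dist_eq, Real.coe_toNNReal _ hf.nonneg]
    exact hf.lip v hv w hw
  exact this.continuousOn

lemma summable_digitProb_mul {v M : ℝ} (hv : v ∈ Set.Icc (0 : ℝ) 1) {a : ℕ → ℝ}
    (ha : ∀ k, |a k| ≤ M) : Summable fun k => digitProb k v * a k := by
  refine Summable.of_norm_bounded ((hasSum_digitProb hv).summable.mul_right M) fun k => ?_
  rw [Real.norm_eq_abs, abs_mul, abs_of_nonneg (digitProb_nonneg k hv.1)]
  exact mul_le_mul_of_nonneg_left (ha k) (digitProb_nonneg k hv.1)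

lemma BddLip.hasSum_gaussTransfer {f : ℝ → ℝ} {M L v : ℝ} (hf : BddLip f M L)
    (hv : v ∈ Set.Icc (0 : ℝ) 1) :
    HasSum (fun k : ℕ => digitProb k v * f (gaussBranch k v)) (gaussTransfer f v) :=
  (summable_digitProb_mul hv fun k => hf.bound _ (gaussBranch_mem k hv)).hasSum

lemma BddLip.abs_gaussTransfer_le {f : ℝ → ℝ} {M L v : ℝ} (hf : BddLip f M L)
    (hv : v ∈ Set.Icc (0 : ℝ) 1) : |gaussTransfer f v| ≤ M := by
  have h := (hasSum_digitProb hv).mul_right M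
  rw [one_mul] at h
  refine (hf.hasSum_gaussTransfer hv).norm_le_of_bounded h fun k => ?_
  rw [Real.norm_eq_abs, abs_mul, abs_of_nonneg (digitProb_nonneg k hv.1)]
  exact mul_le_mul_of_nonneg_left (hf.bound _ (gaussBranch_mem k hv)) (digitProb_nonneg k hv.1)

lemma gaussBranch_sub (k : ℕ) {v w : ℝ} (hv : 0 ≤ v) (hw : 0 ≤ w) :
    gaussBranch k v - gaussBranch k w = (w - v) / (((k : ℝ) + 1 + v) * ((k : ℝ) + 1 + w)) := by
  unfold gaussBranch
  have : (k : ℝ) + 1 + v ≠ 0 := by positivity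
  have : (k : ℝ) + 1 + w ≠ 0 := by positivity
  field_simp
  ring

lemma abs_sum_le_of_digitProb_mul_sub {f : ℝ → ℝ} {M L v w : ℝ} (hf : BddLip f M L)
    (hv : v ∈ Set.Icc (0 : ℝ) 1) (hw : w ∈ Set.Icc (0 : ℝ) 1) (hvw : v ≤ w) {A : ℝ}
    (hA : HasSum (fun k : ℕ => digitProb k v * (f (gaussBranch k v) - f (gaussBranch k w))) A) :
    |A| ≤ 5 / 8 * L * (w - v) := by
  have hL := hf.nonneg
  have hd : 0 ≤ L * (w - v) := mul_nonneg hL (sub_nonneg.2 hvw)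
  have h := (((hasSum_digitProb hv).mul_right (1 / 4)).add
    (hasSum_ite_eq (0 : ℕ) (3 / 8 : ℝ))).mul_left (L * (w - v))
  have e : L * (w - v) * (1 * (1 / 4) + 3 / 8) = 5 / 8 * L * (w - v) := by ring
  rw [e] at h
  refine hA.norm_le_of_bounded h fun k => ?_
  have hP := digitProb_nonneg k hv.1
  rw [Real.norm_eq_abs, abs_mul, abs_of_nonneg hP]
  have hk0 : (0 : ℝ) ≤ k := k.cast_nonneg
  have hlip := hf.lip _ (gaussBranch_mem k hv) _ (gaussBranch_mem k hw)
  rw [gaussBranch_sub k hv.1 hw.1, abs_of_nonneg (div_nonneg (sub_nonneg.2 hvw)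
    (mul_nonneg (by linarith [hv.1]) (by linarith [hw.1])))] at hlip
  have key : digitProb k v * (1 / (((k : ℝ) + 1 + v) * ((k : ℝ) + 1 + w))) ≤
      digitProb k v * (1 / 4) + if k = 0 then 3 / 8 else 0 := by
    rcases Nat.eq_zero_or_pos k with rfl | hk
    · have hP2 := digitProb_le_half 0 hv.1
      have : 1 / ((((0 : ℕ) : ℝ) + 1 + v) * (((0 : ℕ) : ℝ) + 1 + w)) ≤ 1 := by
        rw [div_le_one (by have := hv.1; have := hw.1; positivity)]
        push_cast
        nlinarith [hv.1, hw.1, mul_nonneg hv.1 hw.1]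
      simp only [if_true]
      nlinarith
    · have hk1 : (1 : ℝ) ≤ k := by exact_mod_cast hk
      rw [if_neg hk.ne', add_zero]
      refine mul_le_mul_of_nonneg_left ?_ hP
      exact one_div_le_one_div_of_le (by norm_num) (by nlinarith [hv.1, hw.1])
  calc digitProb k v * |f (gaussBranch k v) - f (gaussBranch k w)|
      ≤ digitProb k v * (L * ((w - v) / (((k : ℝ) + 1 + v) * ((k : ℝ) + 1 + w)))) :=
        mul_le_mul_of_nonneg_left hlip hP
    _ = L * (w - v) * (digitProb k v * (1 / (((k : ℝ) + 1 + v) * ((k : ℝ) + 1 + w)))) := by ring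
    _ ≤ _ := mul_le_mul_of_nonneg_left key hd

/-- The conditional probability that the next partial quotient exceeds `k`. -/
noncomputable def digitTail (k : ℕ) (v : ℝ) : ℝ := (1 + v) / ((k : ℝ) + 1 + v)

lemma digitProb_eq_tail_sub (k : ℕ) {v : ℝ} (hv : 0 ≤ v) :
    digitProb k v = digitTail k v - digitTail (k + 1) v := by
  unfold digitProb digitTail
  have : (k : ℝ) + 1 + v ≠ 0 := by positivity
  have : (k : ℝ) + 2 + v ≠ 0 := by positivity
  have : (k : ℝ) + 1 + 1 + v ≠ 0 := by positivity
  push_cast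
  field_simp
  ring

lemma abs_digitTail_sub_le (k : ℕ) {v w : ℝ} (hv : 0 ≤ v) (hvw : v ≤ w) :
    |digitTail k v - digitTail k w| ≤ k * (w - v) / ((k : ℝ) + 1) ^ 2 := by
  have hw := hv.trans hvw
  have h1 : digitTail k v - digitTail k w =
      -(k * (w - v) / (((k : ℝ) + 1 + v) * ((k : ℝ) + 1 + w))) := by
    unfold digitTail
    have : (k : ℝ) + 1 + v ≠ 0 := by positivity
    have : (k : ℝ) + 1 + w ≠ 0 := by positivity
    field_simp
    ring
  have h0 : 0 ≤ k * (w - v) := mul_nonneg k.cast_nonneg (sub_nonneg.2 hvw)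
  rw [h1, abs_neg, abs_of_nonneg (by positivity)]
  refine div_le_div_of_nonneg_left h0 (by positivity) ?_
  nlinarith [mul_nonneg hv hw, (k.cast_nonneg : (0 : ℝ) ≤ k)]

lemma abs_sum_le_of_digitProb_sub_mul {f : ℝ → ℝ} {M L v w : ℝ} (hf : BddLip f M L)
    (hv : v ∈ Set.Icc (0 : ℝ) 1) (hw : w ∈ Set.Icc (0 : ℝ) 1) (hvw : v ≤ w) {A : ℝ}
    (hA : HasSum (fun k : ℕ => (digitProb k v - digitProb k w) * f (gaussBranch k w)) A) :
    |A| ≤ 1 / 4 * L * (w - v) := by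
  have hL := hf.nonneg
  have hd : 0 ≤ L * (w - v) := mul_nonneg hL (sub_nonneg.2 hvw)
  set g : ℕ → ℝ := fun k => f (gaussBranch k w) with hg
  set D : ℕ → ℝ := fun k => digitTail k v - digitTail k w with hD
  have hPD : ∀ k, digitProb k v - digitProb k w = D k - D (k + 1) := by
    intro k
    rw [digitProb_eq_tail_sub k hv.1, digitProb_eq_tail_sub k hw.1]
    simp only [hD]
    ring
  have hgd : ∀ k, |g (k + 1) - g k| ≤ L * (1 / (((k : ℝ) + 1) * ((k : ℝ) + 2))) := by
    intro k
    refine (hf.lip _ (gaussBranch_mem _ hw) _ (gaussBranch_mem _ hw)).trans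
      (mul_le_mul_of_nonneg_left ?_ hL)
    have hw0 := hw.1
    have e : gaussBranch (k + 1) w - gaussBranch k w =
        -(1 / (((k : ℝ) + 1 + w) * ((k : ℝ) + 2 + w))) := by
      unfold gaussBranch
      have : (k : ℝ) + 1 + w ≠ 0 := by positivity
      have : (k : ℝ) + 2 + w ≠ 0 := by positivity
      have : (k : ℝ) + 1 + 1 + w ≠ 0 := by positivity
      push_cast
      field_simp
      ring
    rw [e, abs_neg, abs_of_nonneg (by positivity)]
    refine one_div_le_one_div_of_le (by positivity) ?_
    have : (0 : ℝ) ≤ k := k.cast_nonneg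
    exact mul_le_mul (by linarith) (by linarith) (by positivity) (by positivity)
  have hpart : ∀ N : ℕ, |∑ k ∈ Finset.range N, (digitProb k v - digitProb k w) * g k + D N * g N|
      ≤ L * (w - v) * (1 / 4 - 1 / (2 * (((N : ℝ) + 1) * ((N : ℝ) + 2)))) := by
    intro N
    induction N with
    | zero =>
      have h1 : (1 : ℝ) + v ≠ 0 := by have := hv.1; positivity
      have h2 : (1 : ℝ) + w ≠ 0 := by have := hw.1; positivity
      have : D 0 = 0 := by simp [hD, digitTail, div_self h1, div_self h2]
      simp [this]
      norm_num
    | succ N ih =>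
      have e : ∑ k ∈ Finset.range (N + 1), (digitProb k v - digitProb k w) * g k
          + D (N + 1) * g (N + 1) =
          (∑ k ∈ Finset.range N, (digitProb k v - digitProb k w) * g k + D N * g N)
            + D (N + 1) * (g (N + 1) - g N) := by
        rw [Finset.sum_range_succ, hPD N]
        ring
      rw [e]
      have h1 : |D (N + 1) * (g (N + 1) - g N)| ≤
          ((N : ℝ) + 1) * (w - v) / ((N : ℝ) + 1 + 1) ^ 2 *
            (L * (1 / (((N : ℝ) + 1) * ((N : ℝ) + 2)))) := by
        rw [abs_mul]
        have := abs_digitTail_sub_le (N + 1) hv.1 hvw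
        push_cast at this
        exact mul_le_mul this (hgd N) (abs_nonneg _) ((abs_nonneg _).trans this)
      have h2 : ((N : ℝ) + 1) * (w - v) / ((N : ℝ) + 1 + 1) ^ 2 *
            (L * (1 / (((N : ℝ) + 1) * ((N : ℝ) + 2)))) =
            L * (w - v) * (1 / ((N : ℝ) + 2) ^ 3) := by
        field_simp
        ring
      have h3 : 1 / ((N : ℝ) + 2) ^ 3 ≤ 1 / (2 * (((N : ℝ) + 1) * ((N : ℝ) + 2))) -
          1 / (2 * (((N : ℝ) + 1 + 1) * ((N : ℝ) + 1 + 2))) := by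
        have e2 : 1 / (2 * (((N : ℝ) + 1) * ((N : ℝ) + 2))) -
          1 / (2 * (((N : ℝ) + 1 + 1) * ((N : ℝ) + 1 + 2))) =
            1 / (((N : ℝ) + 1) * ((N : ℝ) + 2) * ((N : ℝ) + 3)) := by
          field_simp
          ring
        rw [e2]
        refine one_div_le_one_div_of_le (by positivity) ?_
        have : (0 : ℝ) ≤ N := N.cast_nonneg
        nlinarith
      have h4 := mul_le_mul_of_nonneg_left h3 hd
      push_cast
      refine (abs_add_le _ _).trans ?_
      linarith
  have hD0 : Tendsto (fun N : ℕ => D N * g N) atTop (𝓝 0) := by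
    refine squeeze_zero_norm (a := fun N : ℕ => M * (1 / ((N : ℝ) + 1))) (fun N => ?_) ?_
    · have hgM : |g N| ≤ M := hf.bound _ (gaussBranch_mem _ hw)
      have hM := (abs_nonneg _).trans hgM
      have h1 : |D N| ≤ 1 / ((N : ℝ) + 1) := by
        refine (abs_digitTail_sub_le N hv.1 hvw).trans ?_
        rw [div_le_div_iff₀ (by positivity) (by positivity)]
        have : (0 : ℝ) ≤ N := N.cast_nonneg
        have : w - v ≤ 1 := by linarith [hv.1, hw.2]
        nlinarith [mul_nonneg (N.cast_nonneg : (0 : ℝ) ≤ N) (sub_nonneg.2 this)]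
      rw [Real.norm_eq_abs, abs_mul, mul_comm]
      exact mul_le_mul hgM h1 (abs_nonneg _) hM
    · simpa using (tendsto_one_div_add_atTop_nhds_zero_nat (𝕜 := ℝ)).const_mul M
  have hlim := (hA.tendsto_sum_nat.add hD0).abs
  rw [add_zero] at hlim
  refine le_of_tendsto hlim (Eventually.of_forall fun N => (hpart N).trans ?_)
  have : 0 ≤ 1 / (2 * (((N : ℝ) + 1) * ((N : ℝ) + 2))) := by positivity
  nlinarith [mul_nonneg hd this]

/-- The transfer operator contracts Lipschitz constants. -/
lemma BddLip.gaussTransfer {f : ℝ → ℝ} {M L : ℝ} (hf : BddLip f M L) :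
    BddLip (gaussTransfer f) M (7 / 8 * L) := by
  have main : ∀ v ∈ Set.Icc (0 : ℝ) 1, ∀ w ∈ Set.Icc (0 : ℝ) 1, v ≤ w →
      |_root_.gaussTransfer f v - _root_.gaussTransfer f w| ≤ 7 / 8 * L * (w - v) := by
    intro v hv w hw hvw
    have hb : ∀ k, |f (gaussBranch k v)| ≤ M := fun k => hf.bound _ (gaussBranch_mem k hv)
    have hb' : ∀ k, |f (gaussBranch k w)| ≤ M := fun k => hf.bound _ (gaussBranch_mem k hw)
    have s1 := hf.hasSum_gaussTransfer hv
    have s2 := hf.hasSum_gaussTransfer hw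
    have s3 := (summable_digitProb_mul hv hb').hasSum
    have A := abs_sum_le_of_digitProb_mul_sub hf hv hw hvw
      ((s1.sub s3).congr_fun fun k => by ring)
    have B := abs_sum_le_of_digitProb_sub_mul hf hv hw hvw
      ((s3.sub s2).congr_fun fun k => by ring)
    have := abs_add_le (_root_.gaussTransfer f v - ∑' k, digitProb k v * f (gaussBranch k w))
      (∑' k, digitProb k v * f (gaussBranch k w) - _root_.gaussTransfer f w)
    rw [sub_add_sub_cancel] at this
    linarith
  refine ⟨fun v hv => hf.abs_gaussTransfer_le hv, fun v hv w hw => ?_⟩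
  rcases le_total v w with h | h
  · rw [abs_sub_comm v w, abs_of_nonneg (sub_nonneg.2 h)]
    exact main v hv w hw h
  · rw [abs_sub_comm, abs_of_nonneg (sub_nonneg.2 h)]
    exact main w hw v hv h

/-- The integral against the Gauss measure. -/
noncomputable def gaussMean (f : ℝ → ℝ) : ℝ :=
  (1 / Real.log 2) * ∫ v in Set.Ioo (0 : ℝ) 1, f v / (1 + v)

lemma gaussMean_const (c : ℝ) : gaussMean (fun _ => c) = c := by
  have h : ∫ v in Set.Ioo (0 : ℝ) 1, c / (1 + v) = c * Real.log 2 := by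
    rw [← integral_Ioc_eq_integral_Ioo, ← intervalIntegral.integral_of_le zero_le_one]
    rw [intervalIntegral.integral_eq_sub_of_hasDerivAt (f := fun v => c * Real.log (1 + v))]
    · norm_num
    · intro v hv
      rw [Set.uIcc_of_le zero_le_one] at hv
      have h1 : HasDerivAt (fun v : ℝ => 1 + v) 1 v := (hasDerivAt_id v).const_add 1
      exact ((h1.log (by linarith [hv.1])).const_mul c).congr_deriv (by ring)
    · apply ContinuousOn.intervalIntegrable
      rw [Set.uIcc_of_le zero_le_one]
      exact continuousOn_const.div (by fun_prop) fun v hv => by linarith [hv.1]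
  have : Real.log 2 ≠ 0 := (Real.log_pos (by norm_num)).ne'
  rw [gaussMean, h]
  field_simp

lemma integrableOn_div_one_add {f : ℝ → ℝ} (hf : ContinuousOn f (Set.Icc 0 1)) :
    IntegrableOn (fun v => f v / (1 + v)) (Set.Ioo 0 1) := by
  refine IntegrableOn.mono_set (ContinuousOn.integrableOn_compact isCompact_Icc ?_)
    Set.Ioo_subset_Icc_self
  exact hf.div (by fun_prop) fun v hv => by linarith [hv.1]

lemma BddLip.gaussMean_gaussTransfer {f : ℝ → ℝ} {M L : ℝ} (hf : BddLip f M L) :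
    gaussMean (_root_.gaussTransfer f) = gaussMean f := by
  have h1 := hasSum_integral_gaussBranch (integrableOn_div_one_add hf.continuousOn)
  have h2 : HasSum (fun k : ℕ => ∫ v in Set.Ioo (0 : ℝ) 1,
      digitProb k v * f (gaussBranch k v) / (1 + v))
      (∫ v in Set.Ioo (0 : ℝ) 1, _root_.gaussTransfer f v / (1 + v)) := by
    have hM : 0 ≤ M := (abs_nonneg _).trans (hf.bound 0 (by simp))
    refine hasSum_integral_of_dominated_convergence (fun k v => digitProb k v * M) ?_ ?_ ?_ ?_ ?_
    · intro k
      refine ContinuousOn.aestronglyMeasurable ?_ measurableSet_Ioo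
      have hbr : ContinuousOn (gaussBranch k) (Set.Ioo 0 1) := fun s hs =>
        (hasDerivAt_gaussBranch k hs.1.le).continuousAt.continuousWithinAt
      refine ContinuousOn.div (ContinuousOn.mul ?_ ?_) (by fun_prop) fun v hv => by linarith [hv.1]
      · unfold digitProb
        refine ContinuousOn.div (by fun_prop) (by fun_prop) fun v hv => ?_
        have := hv.1
        positivity
      · exact hf.continuousOn.comp hbr fun s hs => gaussBranch_mem k (Set.Ioo_subset_Icc_self hs)
    · intro k
      refine (ae_restrict_iff' measurableSet_Ioo).2 (Eventually.of_forall fun v hv => ?_)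
      have hP := digitProb_nonneg k hv.1.le
      have hb := hf.bound _ (gaussBranch_mem k (Set.Ioo_subset_Icc_self hv))
      rw [Real.norm_eq_abs, abs_div, abs_mul, abs_of_nonneg hP,
        abs_of_pos (by linarith [hv.1] : 0 < 1 + v)]
      have h := mul_le_mul_of_nonneg_left hb hP
      refine (div_le_self (by positivity) (by linarith [hv.1])).trans h
    · refine (ae_restrict_iff' measurableSet_Ioo).2 (Eventually.of_forall fun v hv => ?_)
      exact (hasSum_digitProb (Set.Ioo_subset_Icc_self hv)).summable.mul_right M
    · have hc : IntegrableOn (fun _ : ℝ => M) (Set.Ioo 0 1) := by simp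
      refine hc.congr_fun (fun v hv => ?_) measurableSet_Ioo
      have := (hasSum_digitProb (Set.Ioo_subset_Icc_self hv)).mul_right M
      rw [one_mul] at this
      exact this.tsum_eq.symm
    · refine (ae_restrict_iff' measurableSet_Ioo).2 (Eventually.of_forall fun v hv => ?_)
      exact (hf.hasSum_gaussTransfer (Set.Ioo_subset_Icc_self hv)).div_const _
  unfold gaussMean
  congr 1
  refine h2.unique (h1.congr_fun fun k => ?_)
  refine setIntegral_congr_fun measurableSet_Ioo fun s hs => ?_
  have hs0 := hs.1
  unfold digitProb
  have e : 1 + gaussBranch k s = ((k : ℝ) + 2 + s) / ((k : ℝ) + 1 + s) := by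
    unfold gaussBranch
    field_simp
    ring
  rw [e]
  field_simp

lemma BddLip.abs_sub_gaussMean_le {f : ℝ → ℝ} {M L v : ℝ} (hf : BddLip f M L)
    (hv : v ∈ Set.Icc (0 : ℝ) 1) : |f v - gaussMean f| ≤ L := by
  have hlog : 0 < Real.log 2 := Real.log_pos (by norm_num)
  have mono : ∀ f g : ℝ → ℝ, ContinuousOn f (Set.Icc 0 1) → ContinuousOn g (Set.Icc 0 1) →
      (∀ v ∈ Set.Icc (0 : ℝ) 1, f v ≤ g v) → gaussMean f ≤ gaussMean g := by
    intro f g hf hg h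
    refine mul_le_mul_of_nonneg_left ?_ (by positivity)
    refine setIntegral_mono_on (integrableOn_div_one_add hf) (integrableOn_div_one_add hg)
      measurableSet_Ioo fun u hu => ?_
    exact div_le_div_of_nonneg_right (h u (Set.Ioo_subset_Icc_self hu)) (by linarith [hu.1])
  have hlip : ∀ u ∈ Set.Icc (0 : ℝ) 1, |f v - f u| ≤ L := by
    intro u hu
    refine (hf.lip v hv u hu).trans ?_
    have : |v - u| ≤ 1 := by rw [abs_le]; constructor <;> linarith [hv.1, hv.2, hu.1, hu.2]
    nlinarith [hf.nonneg]
  have h1 := mono f (fun _ => f v + L) hf.continuousOn continuousOn_const fun u hu => by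
    linarith [(abs_le.1 (hlip u hu)).1]
  have h2 := mono (fun _ => f v - L) f continuousOn_const hf.continuousOn fun u hu => by
    linarith [(abs_le.1 (hlip u hu)).2]
  rw [gaussMean_const] at h1 h2
  rw [abs_le]
  constructor <;> linarith

lemma BddLip.iterate_gaussTransfer {f : ℝ → ℝ} {M L : ℝ} (hf : BddLip f M L) (n : ℕ) :
    BddLip (_root_.gaussTransfer^[n] f) M ((7 / 8) ^ n * L) := by
  induction n with
  | zero => simpa using hf
  | succ n ih =>
    rw [Function.iterate_succ_apply', pow_succ', mul_assoc]
    exact ih.gaussTransfer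

lemma BddLip.abs_iterate_sub_gaussMean_le {f : ℝ → ℝ} {M L v : ℝ} (hf : BddLip f M L)
    (hv : v ∈ Set.Icc (0 : ℝ) 1) (n : ℕ) :
    |_root_.gaussTransfer^[n] f v - gaussMean f| ≤ (7 / 8) ^ n * L := by
  have h : gaussMean (_root_.gaussTransfer^[n] f) = gaussMean f := by
    induction n with
    | zero => rfl
    | succ n ih =>
      rw [Function.iterate_succ_apply', (hf.iterate_gaussTransfer n).gaussMean_gaussTransfer, ih]
  rw [← h]
  exact (hf.iterate_gaussTransfer n).abs_sub_gaussMean_le hv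

/-- The natural extension of the Gauss map, in the coordinates `(q_{n-1} / q_n, Tⁿ x)`. -/
noncomputable def gaussNatExt (p : ℝ × ℝ) : ℝ × ℝ := (1 / (⌊1 / p.2⌋ + p.1), gaussMap p.2)

lemma measurable_gaussNatExt : Measurable gaussNatExt := by
  unfold gaussNatExt gaussMap
  refine Measurable.prodMk ?_ (by fun_prop)
  have h : Measurable fun p : ℝ × ℝ => ((⌊1 / p.2⌋ : ℤ) : ℝ) :=
    (measurable_of_countable (fun n : ℤ => (n : ℝ))).comp
      (Int.measurable_floor.comp (by fun_prop))
  exact (measurable_const (a := (1 : ℝ))).div (h.add measurable_fst)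

lemma gaussNatExt_gaussBranch (k : ℕ) (v : ℝ) {s : ℝ} (hs : s ∈ Set.Ico (0 : ℝ) 1) :
    gaussNatExt (v, gaussBranch k s) = (gaussBranch k v, s) := by
  simp only [gaussNatExt, floor_gaussBranch k hs, gaussMap_gaussBranch k hs]
  simp [gaussBranch]

/-- A measurable function on the plane which is bounded by `C`. -/
structure BddMeas₂ (Ψ : ℝ × ℝ → ℝ) (C : ℝ) : Prop where
  meas : Measurable Ψ
  bound : ∀ p, |Ψ p| ≤ C

lemma BddMeas₂.comp_iterate {Ψ : ℝ × ℝ → ℝ} {C : ℝ} (h : BddMeas₂ Ψ C) (n : ℕ) :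
    BddMeas₂ (fun p => Ψ (gaussNatExt^[n] p)) C :=
  ⟨h.meas.comp (measurable_gaussNatExt.iterate n), fun _ => h.bound _⟩

lemma BddMeas₂.mul {Ψ Ψ' : ℝ × ℝ → ℝ} {C C' : ℝ} (h : BddMeas₂ Ψ C) (h' : BddMeas₂ Ψ' C') :
    BddMeas₂ (fun p => Ψ p * Ψ' p) (C * C') :=
  ⟨h.meas.mul h'.meas, fun p => by
    rw [abs_mul]
    exact mul_le_mul (h.bound p) (h'.bound p) (abs_nonneg _) ((abs_nonneg _).trans (h.bound p))⟩

lemma BddMeas₂.sub_const {Ψ : ℝ × ℝ → ℝ} {C : ℝ} (h : BddMeas₂ Ψ C) (c : ℝ) :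
    BddMeas₂ (fun p => Ψ p - c) (C + |c|) :=
  ⟨h.meas.sub_const c, fun p => (abs_sub _ _).trans (by linarith [h.bound p])⟩

lemma BddMeas₂.bddMeas {Ψ : ℝ × ℝ → ℝ} {C : ℝ} (h : BddMeas₂ Ψ C) (v : ℝ) :
    BddMeas (fun t => Ψ (v, t)) C :=
  ⟨h.meas.comp (by fun_prop), fun _ _ => h.bound _⟩

lemma BddMeas₂.hasSum_condInt {Ψ : ℝ × ℝ → ℝ} {C v : ℝ} (h : BddMeas₂ Ψ C)
    (hv : v ∈ Set.Icc (0 : ℝ) 1) :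
    HasSum (fun k : ℕ => digitProb k v *
      condInt (gaussBranch k v) (fun t => Ψ (gaussBranch k v, t)))
      (condInt v fun t => Ψ (gaussNatExt (v, t))) := by
  refine (_root_.hasSum_condInt hv ((h.comp_iterate 1).bddMeas v)).congr_fun fun k => ?_
  congr 1
  refine condInt_congr fun s hs => ?_
  simp [gaussNatExt_gaussBranch k v (Set.Ioo_subset_Ico_self hs)]

lemma BddMeas₂.condInt_iterate {Ψ : ℝ × ℝ → ℝ} {C : ℝ} (h : BddMeas₂ Ψ C) (n : ℕ) {v : ℝ}
    (hv : v ∈ Set.Icc (0 : ℝ) 1) :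
    condInt v (fun t => Ψ (gaussNatExt^[n] (v, t))) =
      gaussTransfer^[n] (fun w => condInt w fun t => Ψ (w, t)) v := by
  induction n generalizing v with
  | zero => rfl
  | succ n ih =>
    have h1 := ((h.comp_iterate n).hasSum_condInt hv).tsum_eq
    simp only [Function.iterate_succ_apply]
    rw [← h1, ← Function.iterate_succ_apply, Function.iterate_succ_apply']
    exact tsum_congr fun k => by rw [ih (gaussBranch_mem k hv)]

lemma abs_iterate_gaussTransfer_le {h : ℝ → ℝ} {C : ℝ} (n : ℕ)
    (hC : ∀ v ∈ Set.Icc (0 : ℝ) 1, |h v| ≤ C) {v : ℝ} (hv : v ∈ Set.Icc (0 : ℝ) 1) :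
    |gaussTransfer^[n] h v| ≤ C := by
  induction n generalizing v with
  | zero => exact hC v hv
  | succ n ih =>
    rw [Function.iterate_succ_apply']
    have hs := (hasSum_digitProb hv).mul_right C
    rw [one_mul] at hs
    rw [← Real.norm_eq_abs]
    refine tsum_of_norm_bounded hs fun k => ?_
    rw [Real.norm_eq_abs, abs_mul, abs_of_nonneg (digitProb_nonneg k hv.1)]
    exact mul_le_mul_of_nonneg_left (ih (gaussBranch_mem k hv)) (digitProb_nonneg k hv.1)

/-- The indicator of the region below the graph of `g`. -/
noncomputable def belowGraph (g : ℝ → ℝ) (p : ℝ × ℝ) : ℝ := if p.2 < g p.1 then 1 else 0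

lemma bddMeas₂_belowGraph {g : ℝ → ℝ} (hg : Measurable g) : BddMeas₂ (belowGraph g) 1 := by
  constructor
  · exact Measurable.ite (measurableSet_lt measurable_snd (hg.comp measurable_fst))
      measurable_const measurable_const
  · intro p
    unfold belowGraph
    split_ifs <;> simp

/-- The conditional probability, given `q_{n-1} / q_n = v`, to lie below the graph of `g`. -/
noncomputable def belowProb (g : ℝ → ℝ) (v : ℝ) : ℝ := (1 + v) * g v / (1 + v * g v)

lemma condInt_belowGraph {g : ℝ → ℝ} {v : ℝ} (hv : 0 ≤ v) (hg : g v ∈ Set.Icc (0 : ℝ) 1) :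
    condInt v (fun t => belowGraph g (v, t)) = belowProb g v := by
  rw [belowProb, ← condInt_indicator_Iio hv hg]
  refine condInt_congr fun t _ => ?_
  by_cases h : t < g v <;> simp [belowGraph, h]

lemma bddLip_condInt_belowGraph {g : ℝ → ℝ} {M L : ℝ} (hg : BddLip g M L) (hgm : Measurable g)
    (hmem : ∀ v ∈ Set.Icc (0 : ℝ) 1, g v ∈ Set.Icc (0 : ℝ) 1) :
    BddLip (fun v => condInt v fun t => belowGraph g (v, t)) 1 (1 + 2 * L) := by
  refine ⟨fun v hv => abs_condInt_le hv fun t _ => (bddMeas₂_belowGraph hgm).bound _,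
    fun v hv w hw => ?_⟩
  rw [condInt_belowGraph hv.1 (hmem v hv), condInt_belowGraph hw.1 (hmem w hw)]
  have h := hg.lip v hv w hw
  obtain ⟨v0, v1⟩ := hv
  obtain ⟨w0, w1⟩ := hw
  obtain ⟨a0, a1⟩ := hmem v ⟨v0, v1⟩
  obtain ⟨b0, b1⟩ := hmem w ⟨w0, w1⟩
  unfold belowProb
  set a := g v
  set b := g w
  have hva := mul_nonneg v0 a0
  have hwb := mul_nonneg w0 b0
  have hvb := mul_nonneg v0 b0
  have e1 : (1 + v) * a / (1 + v * a) - (1 + v) * b / (1 + v * b) =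
      (a - b) * ((1 + v) / ((1 + v * a) * (1 + v * b))) := by
    field_simp
    ring
  have e2 : (1 + v) * b / (1 + v * b) - (1 + w) * b / (1 + w * b) =
      (v - w) * (b * (1 - b) / ((1 + v * b) * (1 + w * b))) := by
    field_simp
    ring
  have i1 : |(1 + v) / ((1 + v * a) * (1 + v * b))| ≤ 2 := by
    rw [abs_of_nonneg (by positivity), div_le_iff₀ (by positivity)]
    nlinarith [mul_nonneg hva hvb]
  have i2 : |b * (1 - b) / ((1 + v * b) * (1 + w * b))| ≤ 1 := by
    have hb := mul_nonneg b0 (sub_nonneg.2 b1)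
    rw [abs_of_nonneg (by positivity), div_le_one (by positivity)]
    nlinarith [mul_nonneg hvb hwb]
  have j1 : |(1 + v) * a / (1 + v * a) - (1 + v) * b / (1 + v * b)| ≤ |a - b| * 2 := by
    rw [e1, abs_mul]
    exact mul_le_mul_of_nonneg_left i1 (abs_nonneg _)
  have j2 : |(1 + v) * b / (1 + v * b) - (1 + w) * b / (1 + w * b)| ≤ |v - w| * 1 := by
    rw [e2, abs_mul]
    exact mul_le_mul_of_nonneg_left i2 (abs_nonneg _)
  have := abs_sub_le ((1 + v) * a / (1 + v * a)) ((1 + v) * b / (1 + v * b))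
    ((1 + w) * b / (1 + w * b))
  nlinarith

lemma condInt_sub {v C C' : ℝ} (hv : v ∈ Set.Icc (0 : ℝ) 1) {Φ Φ' : ℝ → ℝ} (h : BddMeas Φ C)
    (h' : BddMeas Φ' C') : condInt v (fun t => Φ t - Φ' t) = condInt v Φ - condInt v Φ' := by
  unfold condInt
  rw [← integral_sub (h.integrableOn_condDensity_mul hv) (h'.integrableOn_condDensity_mul hv)]
  simp only [mul_sub]

lemma condInt_const_mul (v c : ℝ) (Φ : ℝ → ℝ) :
    condInt v (fun t => c * Φ t) = c * condInt v Φ := by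
  unfold condInt
  rw [← integral_const_mul]
  congr 1
  ext t
  ring

lemma condInt_congr_ae {v : ℝ} {Φ Φ' : ℝ → ℝ} (h : ∀ᵐ t : ℝ, Φ t = Φ' t) :
    condInt v Φ = condInt v Φ' :=
  integral_congr_ae (ae_restrict_of_ae (h.mono fun t ht => by simp only [ht]))

lemma BddMeas.ite_lt_mul {Φ : ℝ → ℝ} {C : ℝ} (h : BddMeas Φ C) (c : ℝ) :
    BddMeas (fun t => (if t < c then 1 else 0) * Φ t) C := by
  refine ⟨(Measurable.ite measurableSet_Iio measurable_const measurable_const).mul h.meas,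
    fun t ht => ?_⟩
  have := h.bound t ht
  split_ifs
  · simpa using this
  · simpa using (abs_nonneg _).trans this

/-- Restricting to an initial interval of `(0, 1)` does not affect exponential convergence of the
conditional means along the natural extension. -/
lemma BddMeas₂.abs_condInt_ite_lt_le {Ψ : ℝ × ℝ → ℝ} {L : ℝ} (h : BddMeas₂ Ψ (3 * L))
    (hΨ : ∀ n : ℕ, ∀ v ∈ Set.Icc (0 : ℝ) 1,
      |condInt v fun t => Ψ (gaussNatExt^[n] (v, t))| ≤ (7 / 8) ^ n * L)
    (n : ℕ) (c : ℝ) {v : ℝ} (hv : v ∈ Set.Icc (0 : ℝ) 1) :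
    |condInt v fun t => (if t < c then 1 else 0) * Ψ (gaussNatExt^[n] (v, t))| ≤
      (7 / 8) ^ n * (3 * L) := by
  induction n generalizing v c with
  | zero =>
    rw [pow_zero, one_mul]
    exact abs_condInt_le hv ((h.bddMeas v).ite_lt_mul c).bound
  | succ n ih =>
    have hL : 0 ≤ L := by
      have := (abs_nonneg _).trans (h.bound 0)
      linarith
    have hpow : (0 : ℝ) ≤ (7 / 8) ^ n := by positivity
    have hnL : 0 ≤ (7 / 8) ^ n * L := mul_nonneg hpow hL
    have hsum := _root_.hasSum_condInt hv (((h.comp_iterate (n + 1)).bddMeas v).ite_lt_mul c)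
    have hterm : ∀ k : ℕ, |condInt (gaussBranch k v) fun s => (if gaussBranch k s < c then 1 else 0)
        * Ψ (gaussNatExt^[n + 1] (v, gaussBranch k s))| ≤ (7 / 8) ^ n * L +
          if k = (⌊1 / c⌋ - 1).toNat then (7 / 8) ^ n * (3 * L) else 0 := by
      intro k
      have hw := gaussBranch_mem k hv
      set w := gaussBranch k v with hwdef
      have hite : 0 ≤ if k = (⌊1 / c⌋ - 1).toNat then (7 / 8) ^ n * (3 * L) else 0 := by
        split_ifs <;> nlinarith
      have e1 : condInt w (fun s => (if gaussBranch k s < c then 1 else 0)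
          * Ψ (gaussNatExt^[n + 1] (v, gaussBranch k s))) =
          condInt w (fun s => (if gaussBranch k s < c then 1 else 0)
          * Ψ (gaussNatExt^[n] (w, s))) := by
        refine condInt_congr fun s hs => ?_
        rw [Function.iterate_succ_apply,
          gaussNatExt_gaussBranch k v (Set.Ioo_subset_Ico_self hs)]
      rw [e1]
      have zero_of : (∀ s ∈ Set.Ioo (0 : ℝ) 1, ¬ gaussBranch k s < c) →
          |condInt w fun s => (if gaussBranch k s < c then 1 else 0)
            * Ψ (gaussNatExt^[n] (w, s))| ≤ (7 / 8) ^ n * L +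
          if k = (⌊1 / c⌋ - 1).toNat then (7 / 8) ^ n * (3 * L) else 0 := by
        intro hz
        rw [condInt_congr (Ψ := fun _ => 0) fun s hs => by simp [hz s hs], condInt_const hw.1]
        simp only [abs_zero]
        linarith
      rcases le_or_gt c 0 with hc | hc
      · exact zero_of fun s hs => not_lt.2 (hc.trans (gaussBranch_pos k hs.1.le).le)
      have hlt : ∀ s ∈ Set.Ioo (0 : ℝ) 1, (gaussBranch k s < c ↔ 1 / c - (k + 1) < s) := by
        intro s hs
        have hp : 0 < (k : ℝ) + 1 + s := by have := hs.1; positivity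
        rw [gaussBranch, div_lt_comm₀ hp hc]
        constructor <;> intro h <;> linarith
      set c' := 1 / c - (k + 1) with hc'
      rcases le_or_gt 1 c' with h1 | h1
      · exact zero_of fun s hs => by rw [hlt s hs]; linarith [hs.2]
      have e2 : condInt w (fun s => (if gaussBranch k s < c then 1 else 0)
          * Ψ (gaussNatExt^[n] (w, s))) =
          condInt w (fun s => Ψ (gaussNatExt^[n] (w, s))) -
          condInt w (fun s => (if s < c' then 1 else 0) * Ψ (gaussNatExt^[n] (w, s))) := by
        have hb := (h.comp_iterate n).bddMeas w
        rw [← condInt_sub hw hb (hb.ite_lt_mul c')]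
        refine (condInt_congr (Ψ := fun s => (if c' < s then 1 else 0)
          * Ψ (gaussNatExt^[n] (w, s))) fun s hs => by simp only [hlt s hs]).trans ?_
        refine condInt_congr_ae ?_
        have : ∀ᵐ s : ℝ, s ≠ c' := by simp [ae_iff]
        filter_upwards [this] with s hs
        rcases lt_or_gt_of_ne hs with hs | hs
        · simp [hs, hs.le.not_gt]
        · simp [hs, hs.le.not_gt]
      rcases le_or_gt c' 0 with h0 | h0
      · have e3 : condInt w (fun s => (if s < c' then 1 else 0) * Ψ (gaussNatExt^[n] (w, s)))
            = 0 := by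
          rw [condInt_congr (Ψ := fun _ => 0) fun s hs => by
            simp [(h0.trans hs.1.le).not_gt], condInt_const hw.1]
        rw [e2, e3, sub_zero]
        linarith [hΨ n w hw]
      · have hk : k = (⌊1 / c⌋ - 1).toNat := by
          have : ⌊1 / c⌋ = (k : ℤ) + 1 := by
            rw [Int.floor_eq_iff]
            push_cast
            constructor <;> linarith
          rw [this]
          simp
        rw [if_pos hk, e2]
        refine (abs_sub _ _).trans (add_le_add (hΨ n w hw) (ih c' hw))
    have hs1 := ((hasSum_digitProb hv).mul_right ((7 / 8) ^ n * L)).add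
      (hasSum_ite_eq ((⌊1 / c⌋ - 1).toNat) (1 / 2 * ((7 / 8) ^ n * (3 * L))))
    have hb := hsum.norm_le_of_bounded hs1 fun k => by
      have hP := digitProb_nonneg k hv.1
      rw [Real.norm_eq_abs, abs_mul, abs_of_nonneg hP]
      refine (mul_le_mul_of_nonneg_left (hterm k) hP).trans ?_
      rw [mul_add]
      refine add_le_add le_rfl ?_
      split_ifs
      · exact mul_le_mul_of_nonneg_right (digitProb_le_half k hv.1) (by nlinarith)
      · simp
    rw [Real.norm_eq_abs] at hb
    refine hb.trans ?_
    rw [pow_succ]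
    nlinarith

/-- Exponential decay of correlations for the region below a Lipschitz graph, along the orbits
`(q_{n-1} / q_n, Tⁿ x)`. -/
lemma exists_correlation_bound {g : ℝ → ℝ} {M L : ℝ} (hg : BddLip g M L) (hgm : Measurable g)
    (hmem : ∀ v ∈ Set.Icc (0 : ℝ) 1, g v ∈ Set.Icc (0 : ℝ) 1) :
    ∃ B : ℝ, ∀ m n : ℕ, |∫ x in Set.Ioo (0 : ℝ) 1,
      (belowGraph g (gaussNatExt^[m] (0, x)) - gaussMean (belowProb g)) *
      (belowGraph g (gaussNatExt^[m + n] (0, x)) - gaussMean (belowProb g))|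
        ≤ B * (7 / 8) ^ n := by
  have hlip := bddLip_condInt_belowGraph hg hgm hmem
  have hmean : gaussMean (belowProb g) =
      gaussMean (fun v => condInt v fun t => belowGraph g (v, t)) := by
    unfold gaussMean
    congr 1
    refine setIntegral_congr_fun measurableSet_Ioo fun v hv => ?_
    simp only
    rw [condInt_belowGraph hv.1.le (hmem v (Set.Ioo_subset_Icc_self hv))]
  rw [hmean]
  set c := gaussMean (fun v => condInt v fun t => belowGraph g (v, t)) with hc
  set K := 1 + 2 * L with hK
  have hL := hg.nonneg
  have hm := bddMeas₂_belowGraph hgm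
  have hc_le : |c| ≤ 1 + K := by
    have h1 := hlip.abs_sub_gaussMean_le (v := 0) (by simp)
    have h2 := hlip.bound 0 (by simp)
    rw [← hc] at h1
    have := abs_sub_abs_le_abs_sub c (condInt 0 fun t => belowGraph g (0, t))
    rw [abs_sub_comm] at h1
    linarith
  have hΨ : BddMeas₂ (fun p => belowGraph g p - c) (3 * K) :=
    ⟨(hm.sub_const c).meas, fun p => ((hm.sub_const c).bound p).trans (by linarith)⟩
  have hconv : ∀ n : ℕ, ∀ v ∈ Set.Icc (0 : ℝ) 1,
      |condInt v fun t => belowGraph g (gaussNatExt^[n] (v, t)) - c| ≤ (7 / 8) ^ n * K := by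
    intro n v hv
    rw [condInt_sub hv ((hm.comp_iterate n).bddMeas v)
      (⟨measurable_const, fun _ _ => le_rfl⟩ : BddMeas (fun _ => c) |c|),
      hm.condInt_iterate n hv, condInt_const hv.1]
    exact hlip.abs_iterate_sub_gaussMean_le hv n
  refine ⟨3 * K + |c| * K, fun m n => ?_⟩
  have hprod := hΨ.mul (hΨ.comp_iterate n)
  have h0 : (0 : ℝ) ∈ Set.Icc (0 : ℝ) 1 := by simp
  have key : ∀ v ∈ Set.Icc (0 : ℝ) 1, |condInt v fun t => (belowGraph g (v, t) - c) *
      (belowGraph g (gaussNatExt^[n] (v, t)) - c)| ≤ (3 * K + |c| * K) * (7 / 8) ^ n := by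
    intro v hv
    have hb := (hΨ.comp_iterate n).bddMeas v
    have e : condInt v (fun t => (belowGraph g (v, t) - c) *
        (belowGraph g (gaussNatExt^[n] (v, t)) - c)) =
        condInt v (fun t => (if t < g v then 1 else 0) *
          (belowGraph g (gaussNatExt^[n] (v, t)) - c)) -
        c * condInt v (fun t => belowGraph g (gaussNatExt^[n] (v, t)) - c) := by
      rw [← condInt_const_mul, ← condInt_sub hv (hb.ite_lt_mul (g v))
        (C' := |c| * (3 * K)) ⟨hb.meas.const_mul c, fun t ht => by
          rw [abs_mul]; exact mul_le_mul_of_nonneg_left (hb.bound t ht) (abs_nonneg c)⟩]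
      refine condInt_congr fun t _ => ?_
      simp only [belowGraph]
      ring
    rw [e]
    refine (abs_sub _ _).trans ?_
    rw [abs_mul]
    have h1 := hΨ.abs_condInt_ite_lt_le hconv n (g v) hv
    have h2 := mul_le_mul_of_nonneg_left (hconv n v hv) (abs_nonneg c)
    linarith
  have := hprod.condInt_iterate m h0
  have e : ∫ x in Set.Ioo (0 : ℝ) 1, (belowGraph g (gaussNatExt^[m] (0, x)) - c) *
      (belowGraph g (gaussNatExt^[m + n] (0, x)) - c) =
      condInt 0 (fun t => (belowGraph g (gaussNatExt^[m] (0, t)) - c) *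
        (belowGraph g (gaussNatExt^[n] (gaussNatExt^[m] (0, t))) - c)) := by
    unfold condInt
    refine setIntegral_congr_fun measurableSet_Ioo fun x _ => ?_
    simp only [condDensity, ← Function.iterate_add_apply, add_comm n m]
    simp
  rw [e, this]
  exact abs_iterate_gaussTransfer_le m key h0

lemma sum_range_pow_sub_le (N : ℕ) :
    ∑ i ∈ Finset.range N, (7 / 8 : ℝ) ^ (N - i) ≤ 7 := by
  induction N with
  | zero => simp
  | succ N ih =>
    have e : ∑ i ∈ Finset.range (N + 1), (7 / 8 : ℝ) ^ (N + 1 - i) =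
        7 / 8 * (∑ i ∈ Finset.range N, (7 / 8 : ℝ) ^ (N - i) + 1) := by
      rw [Finset.sum_range_succ, mul_add, Finset.mul_sum]
      congr 1
      · refine Finset.sum_congr rfl fun i hi => ?_
        rw [Nat.sub_add_comm (Finset.mem_range.1 hi).le, pow_succ']
      · simp
    rw [e]
    linarith

/-- A second-moment strong law of large numbers for bounded nonnegative functions. -/
lemma ae_tendsto_average_of_correlation_bound {α : Type*} [MeasurableSpace α] {μ : Measure α}
    [IsProbabilityMeasure μ] {Y : ℕ → α → ℝ} (hY : ∀ n, Measurable (Y n))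
    (h0 : ∀ n x, 0 ≤ Y n x) (h1 : ∀ n x, Y n x ≤ 1) {c B : ℝ}
    (hB : ∀ m n : ℕ, |∫ x, (Y m x - c) * (Y (m + n) x - c) ∂μ| ≤ B * (7 / 8) ^ n) :
    ∀ᵐ x ∂μ, Tendsto (fun n : ℕ => (∑ k ∈ Finset.range n, Y k x) / n) atTop (𝓝 c) := by
  set y : ℕ → α → ℝ := fun n x => Y n x - c with hy
  have hym : ∀ n, Measurable (y n) := fun n => (hY n).sub_const c
  have hyb : ∀ n x, |y n x| ≤ 1 + |c| := fun n x => by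
    refine (abs_sub _ _).trans ?_
    rw [abs_of_nonneg (h0 n x)]
    linarith [h1 n x]
  have hB0 : 0 ≤ B := by simpa using (abs_nonneg _).trans (hB 0 0)
  have hint : ∀ i j, Integrable (fun x => y i x * y j x) μ := fun i j => by
    refine Integrable.of_bound ((hym i).mul (hym j)).aestronglyMeasurable ((1 + |c|) * (1 + |c|))
      (Eventually.of_forall fun x => ?_)
    rw [Real.norm_eq_abs, abs_mul]
    exact mul_le_mul (hyb i x) (hyb j x) (abs_nonneg _) (by positivity)
  set Z : ℕ → α → ℝ := fun N x => ∑ k ∈ Finset.range N, y k x with hZ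
  have hZsq : ∀ N, Integrable (fun x => Z N x ^ 2) μ := fun N => by
    have e : (fun x => Z N x ^ 2) = fun x => ∑ i ∈ Finset.range N, ∑ j ∈ Finset.range N,
        y i x * y j x := by
      ext x
      rw [sq, Finset.sum_mul_sum]
    rw [e]
    exact integrable_finsetSum _ fun i _ => integrable_finsetSum _ fun j _ => hint i j
  have hvar : ∀ N : ℕ, ∫ x, Z N x ^ 2 ∂μ ≤ 15 * B * N := by
    intro N
    induction N with
    | zero => simp [hZ]
    | succ N ih =>
      have e : ∀ x, Z (N + 1) x ^ 2 = Z N x ^ 2 +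
          (2 * ∑ i ∈ Finset.range N, y i x * y N x + y N x * y N x) := by
        intro x
        simp only [hZ, Finset.sum_range_succ, ← Finset.sum_mul]
        ring
      have hs : Integrable (fun x => ∑ i ∈ Finset.range N, y i x * y N x) μ :=
        integrable_finsetSum _ fun i _ => hint i N
      have hs2 : Integrable (fun x => 2 * ∑ i ∈ Finset.range N, y i x * y N x + y N x * y N x) μ :=
        (hs.const_mul 2).add (hint N N)
      simp_rw [e]
      rw [integral_add (hZsq N) hs2,
        integral_add (hs.const_mul 2) (hint N N), integral_const_mul,
        integral_finsetSum _ fun i _ => hint i N]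
      have b1 : ∑ i ∈ Finset.range N, ∫ x, y i x * y N x ∂μ ≤ B * 7 := by
        calc ∑ i ∈ Finset.range N, ∫ x, y i x * y N x ∂μ
            ≤ ∑ i ∈ Finset.range N, B * (7 / 8) ^ (N - i) := by
              refine Finset.sum_le_sum fun i hi => (le_abs_self _).trans ?_
              have := hB i (N - i)
              rwa [Nat.add_sub_cancel' (Finset.mem_range.1 hi).le] at this
          _ ≤ B * 7 := by
              rw [← Finset.mul_sum]
              exact mul_le_mul_of_nonneg_left (sum_range_pow_sub_le N) hB0
      have b2 : ∫ x, y N x * y N x ∂μ ≤ B := by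
        have := (le_abs_self _).trans (hB N 0)
        simpa using this
      push_cast
      linarith
  have hsub : ∀ᵐ x ∂μ, Tendsto (fun k : ℕ => (Z ((k + 1) ^ 2) x / ((k + 1) ^ 2 : ℕ)) ^ 2)
      atTop (𝓝 0) := by
    set W : ℕ → α → ℝ := fun k x => (Z ((k + 1) ^ 2) x / ((k + 1) ^ 2 : ℕ)) ^ 2 with hW
    have hWi : ∀ k, Integrable (W k) μ := fun k => by
      simp only [hW, div_pow]
      exact (hZsq _).div_const _
    have hWle : ∀ k, ∫ x, W k x ∂μ ≤ 15 * B * (1 / ((k : ℝ) + 1) ^ 2) := fun k => by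
      simp only [hW, div_pow]
      rw [integral_div]
      have h := hvar ((k + 1) ^ 2)
      push_cast at h ⊢
      rw [div_le_iff₀ (by positivity)]
      refine h.trans (le_of_eq ?_)
      field_simp
    have hsum : Summable fun k : ℕ => 15 * B * (1 / ((k : ℝ) + 1) ^ 2) := by
      refine Summable.mul_left _ ?_
      have := (summable_nat_add_iff 1).2 (Real.summable_one_div_nat_pow.2 one_lt_two)
      simpa using this
    have hfin : ∫⁻ x, ∑' k, ENNReal.ofReal (W k x) ∂μ ≠ ⊤ := by
      rw [lintegral_tsum fun k => (hWi k).aestronglyMeasurable.aemeasurable.ennreal_ofReal]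
      refine ne_top_of_le_ne_top hsum.tsum_ofReal_ne_top (ENNReal.tsum_le_tsum fun k => ?_)
      rw [← ofReal_integral_eq_lintegral_ofReal (hWi k)
        (Eventually.of_forall fun x => sq_nonneg _)]
      exact ENNReal.ofReal_le_ofReal (hWle k)
    have hae := ae_lt_top' (AEMeasurable.tsum fun k =>
      (hWi k).aestronglyMeasurable.aemeasurable.ennreal_ofReal) hfin
    filter_upwards [hae] with x hx
    have ht := ENNReal.tendsto_atTop_zero_of_tsum_ne_top hx.ne
    have := (ENNReal.tendsto_toReal ENNReal.zero_ne_top).comp ht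
    refine this.congr fun k => ?_
    exact ENNReal.toReal_ofReal (sq_nonneg _)
  filter_upwards [hsub] with x hx
  have hx' : Tendsto (fun k : ℕ => (∑ i ∈ Finset.range ((k + 1) ^ 2), Y i x) /
      ((k + 1) ^ 2 : ℕ)) atTop (𝓝 c) := by
    have hx2 : Tendsto (fun k : ℕ => Z ((k + 1) ^ 2) x / ((k + 1) ^ 2 : ℕ)) atTop (𝓝 0) := by
      rw [tendsto_zero_iff_abs_tendsto_zero]
      have := (Real.continuous_sqrt.tendsto 0).comp hx
      rw [Real.sqrt_zero] at this
      exact this.congr fun k => Real.sqrt_sq_eq_abs _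
    have := hx2.add_const c
    rw [zero_add] at this
    refine this.congr fun k => ?_
    have hne : (((k + 1) ^ 2 : ℕ) : ℝ) ≠ 0 := by positivity
    simp only [hZ, hy, Finset.sum_sub_distrib, Finset.sum_const, Finset.card_range, nsmul_eq_mul]
    field_simp
    ring
  refine tendsto_div_of_monotone_of_exists_subseq_tendsto_div
    (fun n => ∑ k ∈ Finset.range n, Y k x) c ?_ ?_
  · refine monotone_nat_of_le_succ fun n => ?_
    rw [Finset.sum_range_succ]
    linarith [h0 n x]
  · intro a ha
    refine ⟨fun k => (k + 1) ^ 2, ?_, ?_, hx'⟩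
    · have hlim : Tendsto (fun k : ℕ => (1 + 1 / ((k : ℝ) + 1)) ^ 2) atTop (𝓝 1) := by
        simpa using ((tendsto_one_div_add_atTop_nhds_zero_nat (𝕜 := ℝ)).const_add 1).pow 2
      filter_upwards [hlim.eventually_le_const ha] with k hk
      have e : (((k + 1 + 1) ^ 2 : ℕ) : ℝ) =
          (1 + 1 / ((k : ℝ) + 1)) ^ 2 * (((k + 1) ^ 2 : ℕ) : ℝ) := by
        push_cast
        field_simp
      rw [e]
      exact mul_le_mul_of_nonneg_right hk (by positivity)
    · exact tendsto_atTop_mono (fun k => by simp only [id]; nlinarith) tendsto_id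

/-- Frequencies of visits of `(q_{n-1} / q_n, Tⁿ x)` to the region below a Lipschitz graph. -/
lemma ae_tendsto_belowGraph_average {g : ℝ → ℝ} {M L : ℝ} (hg : BddLip g M L)
    (hgm : Measurable g) (hmem : ∀ v ∈ Set.Icc (0 : ℝ) 1, g v ∈ Set.Icc (0 : ℝ) 1) :
    ∀ᵐ x ∂(volume.restrict (Set.Ioo (0 : ℝ) 1)),
      Tendsto (fun n : ℕ => (∑ k ∈ Finset.range n, belowGraph g (gaussNatExt^[k] (0, x))) / n)
        atTop (𝓝 (gaussMean (belowProb g))) := by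
  obtain ⟨B, hB⟩ := exists_correlation_bound hg hgm hmem
  have : IsProbabilityMeasure (volume.restrict (Set.Ioo (0 : ℝ) 1)) := ⟨by simp⟩
  refine ae_tendsto_average_of_correlation_bound (B := B)
    (Y := fun k x => belowGraph g (gaussNatExt^[k] (0, x))) (fun n => ?_) ?_ ?_ hB
  · exact (((bddMeas₂_belowGraph hgm).comp_iterate n).bddMeas 0).meas
  · intro n x
    unfold belowGraph
    split_ifs <;> norm_num
  · intro n x
    unfold belowGraph
    split_ifs <;> norm_num

lemma iterate_gaussMap_mem {x : ℝ} (hx : x ∈ Set.Ioo (0 : ℝ) 1) (hi : Irrational x) (j : ℕ) :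
    gaussMap^[j] x ∈ Set.Ioo (0 : ℝ) 1 ∧ Irrational (gaussMap^[j] x) := by
  induction j with
  | zero => exact ⟨hx, hi⟩
  | succ j ih =>
    obtain ⟨-, hirr⟩ := ih
    rw [Function.iterate_succ_apply']
    have h1 : Irrational (gaussMap (gaussMap^[j] x)) := by
      unfold gaussMap Int.fract
      rw [one_div]
      exact hirr.inv.sub_intCast _
    refine ⟨⟨lt_of_le_of_ne (Int.fract_nonneg _) (Ne.symm h1.ne_zero), Int.fract_lt_one _⟩, h1⟩

lemma lt_pquot_iff {x : ℝ} (hx : x ∈ Set.Ioo (0 : ℝ) 1) (hi : Irrational x) (l j : ℕ) :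
    (l : ℤ) < pquot x j ↔ gaussMap^[j] x < 1 / ((l : ℝ) + 1) := by
  obtain ⟨⟨h0, h1⟩, hirr⟩ := iterate_gaussMap_mem hx hi j
  have hne : gaussMap^[j] x ≠ 1 / ((l : ℝ) + 1) := by
    intro h
    refine hirr ⟨1 / ((l : ℚ) + 1), ?_⟩
    rw [h]; push_cast; rfl
  have hl : (0 : ℝ) < (l : ℝ) + 1 := by positivity
  rw [← Int.add_one_le_iff, pquot, Int.le_floor]
  push_cast
  rw [le_one_div hl h0]
  exact ⟨fun h => lt_of_le_of_ne h hne, le_of_lt⟩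

lemma pquot_eq (x : ℝ) (j : ℕ) :
    (pquot x j : ℝ) = 1 / gaussMap^[j] x - gaussMap^[j + 1] x := by
  rw [Function.iterate_succ_apply', gaussMap, Int.fract, pquot]
  ring

lemma one_le_pquot {x : ℝ} (hx : x ∈ Set.Ioo (0 : ℝ) 1) (hi : Irrational x) (j : ℕ) :
    1 ≤ pquot x j := by
  have h := (iterate_gaussMap_mem hx hi j).1.2
  have := (lt_pquot_iff hx hi 0 j).2 (by simpa using h)
  exact_mod_cast this

lemma qden_bounds {x : ℝ} (hx : x ∈ Set.Ioo (0 : ℝ) 1) (hi : Irrational x) (j : ℕ) :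
    0 ≤ qden x j ∧ qden x j ≤ qden x (j + 1) ∧ 0 < qden x (j + 1) := by
  induction j with
  | zero => simp [qden]
  | succ j ih =>
    obtain ⟨h0, -, h1⟩ := ih
    have ha := one_le_pquot hx hi j
    have h2 : qden x (j + 1) ≤ qden x (j + 1 + 1) := by
      rw [show qden x (j + 1 + 1) = pquot x j * qden x (j + 1) + qden x j from rfl]
      nlinarith
    exact ⟨h1.le, h2, h1.trans_le h2⟩

lemma iterate_gaussNatExt {x : ℝ} (hx : x ∈ Set.Ioo (0 : ℝ) 1) (hi : Irrational x) (j : ℕ) :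
    gaussNatExt^[j] (0, x) = ((qden x j : ℝ) / qden x (j + 1), gaussMap^[j] x) := by
  induction j with
  | zero => simp [qden]
  | succ j ih =>
    have h : (0 : ℝ) < qden x (j + 1) := by exact_mod_cast (qden_bounds hx hi j).2.2
    rw [Function.iterate_succ_apply', ih, Function.iterate_succ_apply', gaussNatExt,
      show qden x (j + 1 + 1) = pquot x j * qden x (j + 1) + qden x j from rfl]
    ext
    · rw [show ⌊1 / (gaussMap^[j] x)⌋ = pquot x j from rfl]
      push_cast
      rw [add_div' _ _ _ h.ne', one_div_div]
    · rfl

lemma qden_mul_sub_pnum {x : ℝ} (hx : x ∈ Set.Ioo (0 : ℝ) 1) (hi : Irrational x) (j : ℕ) :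
    (qden x (j + 1) : ℝ) * x - pnum x (j + 1) =
      -(gaussMap^[j] x * (qden x j * x - pnum x j)) := by
  induction j with
  | zero => simp [qden, pnum]
  | succ j ih =>
    have h0 := (iterate_gaussMap_mem hx hi j).1.1.ne'
    rw [show qden x (j + 1 + 1) = pquot x j * qden x (j + 1) + qden x j from rfl,
      show pnum x (j + 1 + 1) = pquot x j * pnum x (j + 1) + pnum x j from rfl]
    have h : (qden x j : ℝ) * x - pnum x j =
        -(1 / gaussMap^[j] x * (qden x (j + 1) * x - pnum x (j + 1))) := by
      rw [ih]; field_simp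
    push_cast
    linear_combination h + (qden x (j + 1) * x - pnum x (j + 1)) * pquot_eq x j

lemma abs_qden_mul_sub_pnum {x : ℝ} (hx : x ∈ Set.Ioo (0 : ℝ) 1) (hi : Irrational x) (j : ℕ) :
    |(qden x j : ℝ) * x - pnum x j| * (qden x (j + 1) + gaussMap^[j] x * qden x j) = 1 := by
  induction j with
  | zero => simp [qden, pnum]
  | succ j ih =>
    have h0 := (iterate_gaussMap_mem hx hi j).1.1
    rw [qden_mul_sub_pnum hx hi j, abs_neg, abs_mul, abs_of_pos h0,
      show qden x (j + 1 + 1) = pquot x j * qden x (j + 1) + qden x j from rfl]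
    push_cast
    rw [pquot_eq]
    have h : gaussMap^[j] x * (1 / gaussMap^[j] x) = 1 := mul_one_div_cancel h0.ne'
    linear_combination ih + |(qden x j : ℝ) * x - pnum x j| * qden x (j + 1) * h

lemma medTheta_eq {x : ℝ} (hx : x ∈ Set.Ioo (0 : ℝ) 1) (hi : Irrational x) {l j : ℕ} {v t : ℝ}
    (h : gaussNatExt^[j] (0, x) = (v, t)) (ht : l * t ≤ 1) :
    medTheta x l j = (l + v) * (1 - l * t) / (1 + t * v) := by
  rw [iterate_gaussNatExt hx hi, Prod.mk.injEq] at h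
  obtain ⟨rfl, rfl⟩ := h
  obtain ⟨h0, -, h1⟩ := qden_bounds hx hi j
  have h0' : (0 : ℝ) ≤ qden x j := by exact_mod_cast h0
  have h1' : (0 : ℝ) < qden x (j + 1) := by exact_mod_cast h1
  have ht0 := (iterate_gaussMap_mem hx hi j).1.1
  have hE := abs_qden_mul_sub_pnum hx hi j
  have hpos : 0 < qden x (j + 1) + gaussMap^[j] x * qden x j := by positivity
  rw [medTheta, Theta]
  push_cast
  have : ((l : ℝ) * qden x (j + 1) + qden x j) * x - (l * pnum x (j + 1) + pnum x j) =
      (1 - l * gaussMap^[j] x) * (qden x j * x - pnum x j) := by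
    linear_combination (l : ℝ) * qden_mul_sub_pnum hx hi j
  rw [this, abs_mul, abs_of_nonneg (sub_nonneg.2 ht), eq_div_of_mul_eq hpos.ne' hE]
  field_simp

lemma medTheta_bounds {l : ℕ} (hl : 1 ≤ l) {x : ℝ} (hx : x ∈ Set.Ioo (0 : ℝ) 1)
    (hi : Irrational x) {j : ℕ} (hj : (l : ℤ) < pquot x j) :
    (l : ℝ) / ((l : ℝ) + 1) < medTheta x l j ∧ medTheta x l j < (l : ℝ) + 1 := by
  have ht := (lt_pquot_iff hx hi l j).1 hj
  have ht0 := (iterate_gaussMap_mem hx hi j).1.1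
  have hl' : (1 : ℝ) ≤ l := by exact_mod_cast hl
  obtain ⟨h0, h01, h1⟩ := qden_bounds hx hi j
  have h1' : (0 : ℝ) < qden x (j + 1) := by exact_mod_cast h1
  have hv0 : (0 : ℝ) ≤ (qden x j : ℝ) / qden x (j + 1) := by positivity
  have hv1 : (qden x j : ℝ) / qden x (j + 1) ≤ 1 := by
    rw [div_le_one h1']; exact_mod_cast h01
  have hst := iterate_gaussNatExt hx hi j
  set v := (qden x j : ℝ) / qden x (j + 1)
  set t := gaussMap^[j] x
  rw [lt_div_iff₀ (by positivity)] at ht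
  rw [medTheta_eq hx hi hst (by nlinarith), div_lt_div_iff₀ (by positivity) (by positivity),
    div_lt_iff₀ (by positivity)]
  have hvt : 0 ≤ v * t := by positivity
  have hvt1 : v * t ≤ t := mul_le_of_le_one_left ht0.le hv1
  constructor
  · have : 0 < (1 - t * (l + 1)) * (l ^ 2 + v * (l + 1)) :=
      mul_pos (by linarith) (by positivity)
    nlinarith
  · nlinarith [mul_nonneg hvt (by linarith : (0:ℝ) ≤ l), mul_pos ht0 (by linarith : (0:ℝ) < l)]

/-- For `v, t ≥ 0`, the inequality `(l + v) (1 - l t) / (1 + t v) ≤ z` means `t ≥ mediantLevel l z v`. -/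
noncomputable def mediantLevel (l : ℕ) (z v : ℝ) : ℝ :=
  ((l : ℝ) + v - z) / (z * v + (l : ℝ) ^ 2 + l * v)

/-- `mediantLevel` truncated to `[0, 1 / (l + 1)]`. -/
noncomputable def mediantCut (l : ℕ) (z v : ℝ) : ℝ :=
  max 0 (min (1 / ((l : ℝ) + 1)) (mediantLevel l z v))

lemma one_le_mediantLevel_denom {l : ℕ} (hl : 1 ≤ l) {z v : ℝ} (hz : 0 < z) (hv : 0 ≤ v) :
    1 ≤ z * v + (l : ℝ) ^ 2 + l * v := by
  have hl' : (1 : ℝ) ≤ l := by exact_mod_cast hl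
  have : 0 ≤ z * v := by positivity
  nlinarith

lemma measurable_mediantCut (l : ℕ) (z : ℝ) : Measurable (mediantCut l z) := by
  unfold mediantCut mediantLevel
  fun_prop

lemma abs_truncate_sub_le (b c d : ℝ) :
    |max 0 (min b c) - max 0 (min b d)| ≤ |c - d| := by
  have h := abs_max_sub_max_le_max 0 (min b c) 0 (min b d)
  have h' := abs_min_sub_min_le_max b c b d
  rw [sub_self, abs_zero, max_eq_right (abs_nonneg (_ : ℝ))] at h h'
  exact h.trans h'

lemma mediantCut_mem (l : ℕ) (z v : ℝ) : mediantCut l z v ∈ Set.Icc (0 : ℝ) 1 := by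
  refine ⟨le_max_left _ _, max_le zero_le_one ((min_le_left _ _).trans ?_)⟩
  rw [div_le_one (by positivity)]
  linarith [(Nat.cast_nonneg l : (0 : ℝ) ≤ l)]

lemma bddLip_mediantCut {l : ℕ} (hl : 1 ≤ l) {z : ℝ} (hz : 0 < z) :
    BddLip (mediantCut l z) 1 (z ^ 2) where
  bound v _ := by
    rw [abs_of_nonneg (mediantCut_mem l z v).1]
    exact (mediantCut_mem l z v).2
  lip v hv w hw := by
    refine (abs_truncate_sub_le _ _ _).trans ?_
    have h1 := one_le_mediantLevel_denom hl hz hv.1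
    have h2 := one_le_mediantLevel_denom hl hz hw.1
    rw [mediantLevel, mediantLevel, div_sub_div _ _ (by positivity) (by positivity), abs_div,
      div_le_iff₀ (by positivity)]
    have : ((l : ℝ) + v - z) * (z * w + l ^ 2 + l * w) -
        (z * v + l ^ 2 + l * v) * (l + w - z) = z ^ 2 * (v - w) := by ring
    rw [this, abs_mul, abs_of_nonneg (sq_nonneg z)]
    refine le_mul_of_one_le_right (by positivity) ?_
    rw [abs_of_pos (by positivity)]
    nlinarith

lemma abs_mediantCut_sub_le {l : ℕ} (hl : 1 ≤ l) {z w v : ℝ} (hz : 0 < z) (hw : 0 < w)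
    (hv : 0 ≤ v) : |mediantCut l z v - mediantCut l w v| ≤ |z - w| := by
  refine (abs_truncate_sub_le _ _ _).trans ?_
  have h1 := one_le_mediantLevel_denom hl hz hv
  have h2 := one_le_mediantLevel_denom hl hw hv
  have hl' : (1 : ℝ) ≤ l := by exact_mod_cast hl
  rw [mediantLevel, mediantLevel, div_sub_div _ _ (by positivity) (by positivity), abs_div,
    div_le_iff₀ (by positivity)]
  have : ((l : ℝ) + v - z) * (w * v + l ^ 2 + l * v) -
      (z * v + l ^ 2 + l * v) * (l + v - w) = (w - z) * (l + v) ^ 2 := by ring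
  rw [this, abs_mul, abs_sub_comm w z, abs_of_nonneg (sq_nonneg ((l : ℝ) + v))]
  refine mul_le_mul_of_nonneg_left ?_ (abs_nonneg _)
  rw [abs_of_pos (by positivity), sq]
  have h3 : (l : ℝ) + v ≤ z * v + l ^ 2 + l * v := by
    have : 0 ≤ z * v := by positivity
    nlinarith
  have h4 : (l : ℝ) + v ≤ w * v + l ^ 2 + l * v := by
    have : 0 ≤ w * v := by positivity
    nlinarith
  exact mul_le_mul h3 h4 (by positivity) (by positivity)

lemma lt_mediantCut_iff {l : ℕ} (hl : 1 ≤ l) {z v t : ℝ} (hz : 0 < z) (hv : 0 ≤ v) (ht : 0 < t) :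
    t < mediantCut l z v ↔
      t < 1 / ((l : ℝ) + 1) ∧ z < ((l : ℝ) + v) * (1 - l * t) / (1 + t * v) := by
  have h1 := one_le_mediantLevel_denom hl hz hv
  rw [mediantCut, lt_max_iff, lt_min_iff, mediantLevel, lt_div_iff₀ (by positivity),
    lt_div_iff₀ (by positivity), lt_div_iff₀ (by positivity)]
  constructor
  · rintro (h | ⟨h, h'⟩)
    · linarith
    · exact ⟨h, by linarith⟩
  · rintro ⟨h, h'⟩
    exact Or.inr ⟨h, by linarith⟩

lemma gaussMean_belowProb {g : ℝ → ℝ} (hg : ∀ v ∈ Set.Icc (0 : ℝ) 1, 0 ≤ g v) :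
    gaussMean (belowProb g) = (1 / Real.log 2) * ∫ v in (0 : ℝ)..1, g v / (1 + v * g v) := by
  rw [gaussMean, intervalIntegral.integral_of_le zero_le_one, integral_Ioc_eq_integral_Ioo]
  congr 1
  refine setIntegral_congr_fun measurableSet_Ioo fun v hv => ?_
  have : 0 ≤ v * g v := mul_nonneg hv.1.le (hg v ⟨hv.1.le, hv.2.le⟩)
  have := hv.1
  simp only [belowProb]
  field_simp

lemma continuousOn_div_one_add_mul {g : ℝ → ℝ} {M L : ℝ} (h : BddLip g M L)
    (hg : ∀ v ∈ Set.Icc (0 : ℝ) 1, 0 ≤ g v) :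
    ContinuousOn (fun v => g v / (1 + v * g v)) (Set.Icc 0 1) := by
  have := h.continuousOn
  refine this.div (continuousOn_const.add (continuousOn_id.mul this)) fun v hv => ?_
  have : 0 ≤ v * g v := mul_nonneg hv.1 (hg v hv)
  positivity

lemma abs_gaussMean_belowProb_sub_le {g g' : ℝ → ℝ} {M L M' L' δ : ℝ} (h : BddLip g M L)
    (h' : BddLip g' M' L') (hg : ∀ v ∈ Set.Icc (0 : ℝ) 1, 0 ≤ g v)
    (hg' : ∀ v ∈ Set.Icc (0 : ℝ) 1, 0 ≤ g' v)
    (hd : ∀ v ∈ Set.Icc (0 : ℝ) 1, |g v - g' v| ≤ δ) :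
    |gaussMean (belowProb g) - gaussMean (belowProb g')| ≤ 1 / Real.log 2 * δ := by
  have hlog : 0 < Real.log 2 := Real.log_pos one_lt_two
  rw [gaussMean_belowProb hg, gaussMean_belowProb hg', ← mul_sub, abs_mul,
    abs_of_pos (by positivity)]
  refine mul_le_mul_of_nonneg_left ?_ (by positivity)
  rw [← intervalIntegral.integral_sub
    (ContinuousOn.intervalIntegrable (by
      rw [Set.uIcc_of_le zero_le_one]; exact continuousOn_div_one_add_mul h hg))
    (ContinuousOn.intervalIntegrable (by
      rw [Set.uIcc_of_le zero_le_one]; exact continuousOn_div_one_add_mul h' hg'))]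
  rw [← Real.norm_eq_abs]
  refine (intervalIntegral.norm_integral_le_of_norm_le_const (C := δ) fun v hv => ?_).trans
    (by simp)
  rw [Set.uIoc_of_le zero_le_one] at hv
  have hv' : v ∈ Set.Icc (0 : ℝ) 1 := ⟨hv.1.le, hv.2⟩
  have h1 : 0 ≤ v * g v := mul_nonneg hv'.1 (hg v hv')
  have h2 : 0 ≤ v * g' v := mul_nonneg hv'.1 (hg' v hv')
  refine le_trans ?_ (hd v hv')
  rw [Real.norm_eq_abs, div_sub_div _ _ (by positivity) (by positivity), abs_div,
    div_le_iff₀ (by positivity)]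
  have : g v * (1 + v * g' v) - (1 + v * g v) * g' v = g v - g' v := by ring
  rw [this]
  refine le_mul_of_one_le_right (abs_nonneg _) ?_
  rw [abs_of_pos (by positivity)]
  nlinarith

lemma hasDerivAt_log_add_div (a z v : ℝ) (h : a + v ≠ 0) :
    HasDerivAt (fun v => Real.log (a + v) + z / (a + v)) (1 / (a + v) - z / (a + v) ^ 2) v := by
  have h1 : HasDerivAt (fun v => a + v) 1 v := (hasDerivAt_id v).const_add a
  refine ((h1.log h).add ((hasDerivAt_const v z).div h1 h)).congr_deriv ?_
  ring

lemma integral_inv_sub_div_sq {a z x y : ℝ} (hx : 0 < a + x) (hxy : x ≤ y) :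
    ∫ v in x..y, (1 / (a + v) - z / (a + v) ^ 2) =
      Real.log (a + y) + z / (a + y) - (Real.log (a + x) + z / (a + x)) := by
  have hne : ∀ v ∈ Set.uIcc x y, a + v ≠ 0 := by
    intro v hv
    rw [Set.uIcc_of_le hxy] at hv
    linarith [hv.1]
  refine intervalIntegral.integral_eq_sub_of_hasDerivAt
    (f := fun v => Real.log (a + v) + z / (a + v))
    (fun v hv => hasDerivAt_log_add_div a z v (hne v hv)) ?_
  refine ContinuousOn.intervalIntegrable fun v hv => ContinuousAt.continuousWithinAt ?_
  have := hne v hv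
  fun_prop (disch := simpa using this)

lemma gaussMean_belowProb_const (l : ℕ) :
    gaussMean (belowProb fun _ => 1 / ((l : ℝ) + 1)) =
      1 / Real.log 2 * Real.log (((l : ℝ) + 2) / (l + 1)) := by
  rw [gaussMean_belowProb fun _ _ => by positivity]
  congr 1
  have : ∫ v in (0 : ℝ)..1, 1 / ((l : ℝ) + 1) / (1 + v * (1 / (l + 1))) =
      ∫ v in (0 : ℝ)..1, (1 / (((l : ℝ) + 1) + v) - 0 / (((l : ℝ) + 1) + v) ^ 2) := by
    refine intervalIntegral.integral_congr fun v hv => ?_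
    rw [Set.uIcc_of_le zero_le_one] at hv
    have := hv.1
    field_simp
    ring
  rw [this, integral_inv_sub_div_sq (by positivity) zero_le_one,
    Real.log_div (by positivity) (by positivity)]
  simp only [zero_div, add_zero]
  ring_nf

lemma gaussMean_belowProb_mediantCut {l : ℕ} (hl : 1 ≤ l) {z : ℝ}
    (hz : (l : ℝ) / (l + 1) ≤ z) (hz' : z ≤ l + 1) :
    gaussMean (belowProb (mediantCut l z)) =
      1 / Real.log 2 * (Real.log (((l : ℝ) + 2) / (l + 1)) * (1 - dist7 l z)) := by
  have hl' : (1 : ℝ) ≤ l := by exact_mod_cast hl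
  have hl0 : (0 : ℝ) < l := by linarith
  have hz0 : 0 < z := lt_of_lt_of_le (by positivity) hz
  have hC : Real.log (((l : ℝ) + 2) / (l + 1)) ≠ 0 := by
    refine (Real.log_pos ?_).ne'
    rw [one_lt_div (by positivity)]
    linarith
  rw [gaussMean_belowProb fun v _ => (mediantCut_mem l z v).1]
  congr 1
  have hF := continuousOn_div_one_add_mul (bddLip_mediantCut hl hz0)
    fun v _ => (mediantCut_mem l z v).1
  set F : ℝ → ℝ := fun v => mediantCut l z v / (1 + v * mediantCut l z v) with hFdef
  have hint : ∀ x y, 0 ≤ x → x ≤ y → y ≤ 1 → IntervalIntegrable F volume x y := by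
    intro x y hx hxy hy
    refine (hF.mono ?_).intervalIntegrable
    rw [Set.uIcc_of_le hxy]
    exact Set.Icc_subset_Icc hx hy
  have hsplit : ∀ y, 0 ≤ y → y ≤ 1 →
      ∫ v in (0 : ℝ)..1, F v = (∫ v in (0 : ℝ)..y, F v) + ∫ v in y..1, F v := fun y hy hy' =>
    (intervalIntegral.integral_add_adjacent_intervals (hint 0 y le_rfl hy hy')
      (hint y 1 hy hy' le_rfl)).symm
  have hlow : ∀ v, 0 ≤ v → (l : ℝ) + v ≤ z → F v = 0 := by
    intro v hv hvz
    have h1 := one_le_mediantLevel_denom hl hz0 hv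
    have : mediantLevel l z v ≤ 0 := div_nonpos_of_nonpos_of_nonneg (by linarith) (by linarith)
    have : mediantCut l z v = 0 := max_eq_left ((min_le_right _ _).trans this)
    simp [hFdef, this]
  have hhigh : ∀ v, 0 ≤ v → z * (l + 1 + v) ≤ l + v →
      F v = 1 / (((l : ℝ) + 1) + v) - 0 / (((l : ℝ) + 1) + v) ^ 2 := by
    intro v hv hvz
    have h1 := one_le_mediantLevel_denom hl hz0 hv
    have : 1 / ((l : ℝ) + 1) ≤ mediantLevel l z v := by
      rw [mediantLevel, div_le_div_iff₀ (by positivity) (by positivity)]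
      linarith
    have : mediantCut l z v = 1 / ((l : ℝ) + 1) := by
      rw [mediantCut, min_eq_left this, max_eq_right (by positivity)]
    simp only [hFdef, this]
    field_simp
    ring
  have hmid : ∀ v, 0 ≤ v → z ≤ l + v → l + v ≤ z * (l + 1 + v) →
      F v = 1 / ((l : ℝ) + v) - z / ((l : ℝ) + v) ^ 2 := by
    intro v hv hv1 hv2
    have h1 := one_le_mediantLevel_denom hl hz0 hv
    have h2 : mediantLevel l z v ≤ 1 / ((l : ℝ) + 1) := by
      rw [mediantLevel, div_le_div_iff₀ (by positivity) (by positivity)]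
      linarith
    have h3 : 0 ≤ mediantLevel l z v := div_nonneg (by linarith) (by linarith)
    have h4 : mediantCut l z v = mediantLevel l z v := by
      rw [mediantCut, min_eq_right h2, max_eq_right h3]
    have h5 : 1 + v * mediantLevel l z v ≠ 0 := by positivity
    have h6 : z * v + (l : ℝ) ^ 2 + l * v ≠ 0 := by positivity
    have h7 : (1 + v * mediantLevel l z v) * (z * v + (l : ℝ) ^ 2 + l * v) = (l + v) ^ 2 := by
      rw [mediantLevel]
      field_simp
      ring
    simp only [hFdef, h4]
    rw [div_eq_iff h5, ← mul_left_inj' h6, mul_assoc, h7, mediantLevel]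
    field_simp
  rw [div_le_iff₀ (by positivity)] at hz
  have hcongr : ∀ {x y : ℝ} {G : ℝ → ℝ}, x ≤ y → (∀ v, x ≤ v → v ≤ y → F v = G v) →
      ∫ v in x..y, F v = ∫ v in x..y, G v := by
    intro x y G hxy h
    refine intervalIntegral.integral_congr fun v hv => ?_
    rw [Set.uIcc_of_le hxy] at hv
    exact h v hv.1 hv.2
  rw [dist7, mul_sub, mul_one, ← mul_assoc, mul_one_div_cancel hC, one_mul,
    Real.log_div (by positivity) (by positivity)]
  split_ifs with h1 h2
  · rw [le_div_iff₀ (by positivity)] at h1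
    have hz1 : 0 < 1 - z := by nlinarith
    obtain ⟨w, hw⟩ : ∃ w, w = (z * (l + 1) - l) / (1 - z) := ⟨_, rfl⟩
    have hw0 : 0 ≤ w := by rw [hw]; exact div_nonneg (by linarith) hz1.le
    have hw1 : w ≤ 1 := by rw [hw, div_le_one hz1]; linarith
    have hwl : (l : ℝ) + w = z / (1 - z) := by rw [hw]; field_simp; ring
    have hwl' : (l : ℝ) + 1 + w = 1 / (1 - z) := by rw [hw]; field_simp; ring
    have hweq : w * (1 - z) = z * (l + 1) - l := by rw [hw]; field_simp
    rw [hsplit w hw0 hw1,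
      hcongr hw0 fun v hv hv' => hmid v hv (by nlinarith) (by nlinarith),
      hcongr hw1 fun v hv hv' => hhigh v (hw0.trans hv) (by nlinarith),
      integral_inv_sub_div_sq (by positivity) hw0, integral_inv_sub_div_sq (by positivity) hw1,
      hwl, hwl', Real.log_div (by positivity) hz1.ne', Real.log_div (by positivity) hz1.ne',
      Real.log_div hl0.ne' (by positivity), Real.log_mul (by positivity) (by positivity),
      Real.log_one, div_div_cancel₀ hz0.ne', show (l : ℝ) + 1 + 1 = l + 2 by ring, add_zero]
    field_simp
    ring
  · rw [not_le, div_lt_iff₀ (by positivity)] at h1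
    rw [hcongr zero_le_one fun v hv hv' => hmid v hv (by linarith) (by nlinarith),
      integral_inv_sub_div_sq (by positivity) zero_le_one,
      Real.log_div (by positivity) (by positivity), Real.log_mul (by positivity) (by positivity),
      Real.log_pow, add_zero]
    push_cast
    field_simp
    ring
  · rw [not_le] at h2
    have hw0 : 0 ≤ z - l := by linarith
    have hw1 : z - l ≤ 1 := by linarith
    rw [hsplit (z - l) hw0 hw1,
      hcongr hw0 fun v hv hv' => hlow v hv (by linarith),
      hcongr hw1 fun v hv hv' => hmid v (hw0.trans hv) (by linarith) (by nlinarith),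
      integral_inv_sub_div_sq (by linarith) hw1, intervalIntegral.integral_zero,
      add_sub_cancel, div_self hz0.ne',
      Real.log_div (by positivity) (by positivity), Real.log_mul (by positivity) (by positivity),
      Real.log_pow]
    push_cast
    ring

lemma card_filter_nth (p s : ℕ → Prop) [DecidablePred p] [DecidablePred s]
    (hp : {j | p j}.Infinite) (n : ℕ) :
    ((Finset.range n).filter fun k => s (Nat.nth p k)).card =
      ((Finset.range (Nat.nth p n)).filter fun j => p j ∧ s j).card := by
  refine Finset.card_nbij' (Nat.nth p) (Nat.count p) ?_ ?_ ?_ ?_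
  · intro k hk
    simp only [Finset.coe_filter, Finset.mem_range, Set.mem_ofPred_eq] at hk ⊢
    exact ⟨Nat.nth_strictMono hp hk.1, Nat.nth_mem_of_infinite hp k, hk.2⟩
  · intro j hj
    simp only [Finset.coe_filter, Finset.mem_range, Set.mem_ofPred_eq] at hj ⊢
    refine ⟨(Nat.nth_strictMono hp).lt_iff_lt.1 ?_, ?_⟩
    · rw [Nat.nth_count hj.2.1]
      exact hj.1
    · rw [Nat.nth_count hj.2.1]
      exact hj.2.2
  · intro k _
    exact Nat.count_nth_of_infinite hp k
  · intro j hj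
    simp only [Finset.coe_filter, Finset.mem_range, Set.mem_ofPred_eq] at hj
    exact Nat.nth_count hj.2.1

lemma infinite_of_tendsto_card_div {p : ℕ → Prop} [DecidablePred p] {α : ℝ} (hα : 0 < α)
    (h : Tendsto (fun n : ℕ => (((Finset.range n).filter p).card : ℝ) / n) atTop (𝓝 α)) :
    {j | p j}.Infinite := by
  intro hfin
  have h0 : Tendsto (fun n : ℕ => (hfin.toFinset.card : ℝ) / n) atTop (𝓝 0) :=
    tendsto_const_div_atTop_nhds_zero_nat _
  refine hα.not_ge (le_of_tendsto_of_tendsto' h h0 fun n => ?_)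
  gcongr
  intro j hj
  simpa using (Finset.mem_filter.1 hj).2

lemma tendsto_card_filter_nth_div {p s : ℕ → Prop} [DecidablePred p] [DecidablePred s]
    {α β : ℝ} (hα : 0 < α)
    (hp : Tendsto (fun n : ℕ => (((Finset.range n).filter p).card : ℝ) / n) atTop (𝓝 α))
    (hs : Tendsto (fun n : ℕ => (((Finset.range n).filter fun j => p j ∧ s j).card : ℝ) / n)
      atTop (𝓝 β)) :
    Tendsto (fun n : ℕ => (((Finset.range n).filter fun k => s (Nat.nth p k)).card : ℝ) / n)
      atTop (𝓝 (β / α)) := by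
  have hinf := infinite_of_tendsto_card_div hα hp
  have hnth : Tendsto (Nat.nth p) atTop atTop := (Nat.nth_strictMono hinf).tendsto_atTop
  refine ((hs.comp hnth).div (hp.comp hnth) hα.ne').congr' ?_
  filter_upwards [hnth.eventually_gt_atTop 0] with n hn
  have hcount : ((Finset.range (Nat.nth p n)).filter p).card = n := by
    rw [← Nat.count_eq_card_filter_range, Nat.count_nth_of_infinite hinf]
  have hn' : ((Nat.nth p n : ℕ) : ℝ) ≠ 0 := by positivity
  simp only [Pi.div_apply, Function.comp_apply]
  rw [card_filter_nth p s hinf, hcount, div_div_div_cancel_right₀ hn']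

lemma tendsto_of_tendsto_rat_of_monotone {F : ℕ → ℝ → ℝ} {G : ℝ → ℝ} {K : ℝ}
    (hmono : ∀ n, Monotone (F n)) (hlim : ∀ r : ℚ, 0 < r → Tendsto (fun n => F n r) atTop (𝓝 (G r)))
    (hG : ∀ z w, 0 < z → 0 < w → |G z - G w| ≤ K * |z - w|) {z : ℝ} (hz : 0 < z) :
    Tendsto (fun n => F n z) atTop (𝓝 (G z)) := by
  have hcont : ContinuousAt G z := by
    refine tendsto_iff_dist_tendsto_zero.2 ?_
    have h0 : Tendsto (fun w => K * |w - z|) (𝓝 z) (𝓝 0) := by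
      have : ContinuousAt (fun w : ℝ => K * |w - z|) z := by fun_prop
      simpa [ContinuousAt] using this
    refine squeeze_zero' (Eventually.of_forall fun w => dist_nonneg) ?_ h0
    filter_upwards [lt_mem_nhds hz] with w hw
    exact hG w z hw hz
  refine tendsto_order.2 ⟨fun a ha => ?_, fun a ha => ?_⟩
  · have h1 : ∀ᶠ w in 𝓝 z, a < G w ∧ 0 < w := (hcont.eventually_const_lt ha).and (lt_mem_nhds hz)
    obtain ⟨y, hy, hyz⟩ := exists_Ioc_subset_of_mem_nhds h1 ⟨0, hz⟩
    obtain ⟨r, hr1, hr2⟩ := exists_rat_btwn hy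
    obtain ⟨h2, h3⟩ := hyz ⟨hr1, hr2.le⟩
    filter_upwards [(hlim r (by exact_mod_cast h3)).eventually_const_lt h2] with n hn
    exact hn.trans_le (hmono n hr2.le)
  · have h1 : ∀ᶠ w in 𝓝 z, G w < a ∧ 0 < w := (hcont.eventually_lt_const ha).and (lt_mem_nhds hz)
    obtain ⟨y, hy, hyz⟩ := exists_Ico_subset_of_mem_nhds h1 ⟨z + 1, by linarith⟩
    obtain ⟨r, hr1, hr2⟩ := exists_rat_btwn hy
    obtain ⟨h2, h3⟩ := hyz ⟨hr1.le, hr2⟩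
    filter_upwards [(hlim r (by exact_mod_cast h3)).eventually_lt_const h2] with n hn
    exact (hmono n hr1.le).trans_lt hn

lemma card_filter_lt_pquot {x : ℝ} (hx : x ∈ Set.Ioo (0 : ℝ) 1) (hi : Irrational x) (l n : ℕ) :
    (((Finset.range n).filter fun j => (l : ℤ) < pquot x j).card : ℝ) =
      ∑ j ∈ Finset.range n,
        belowGraph (fun _ => 1 / ((l : ℝ) + 1)) (gaussNatExt^[j] (0, x)) := by
  rw [Finset.natCast_card_filter]
  refine Finset.sum_congr rfl fun j _ => ?_
  rw [iterate_gaussNatExt hx hi]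
  simp only [belowGraph, lt_pquot_iff hx hi]

lemma card_filter_medTheta_le {l : ℕ} (hl : 1 ≤ l) {x : ℝ} (hx : x ∈ Set.Ioo (0 : ℝ) 1)
    (hi : Irrational x) {z : ℝ} (hz : 0 < z) (n : ℕ) :
    (((Finset.range n).filter fun j => (l : ℤ) < pquot x j ∧ medTheta x l j ≤ z).card : ℝ) =
      ∑ j ∈ Finset.range n,
          belowGraph (fun _ => 1 / ((l : ℝ) + 1)) (gaussNatExt^[j] (0, x)) -
        ∑ j ∈ Finset.range n, belowGraph (mediantCut l z) (gaussNatExt^[j] (0, x)) := by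
  rw [Finset.natCast_card_filter, ← Finset.sum_sub_distrib]
  refine Finset.sum_congr rfl fun j _ => ?_
  have hst := iterate_gaussNatExt hx hi j
  have ht0 := (iterate_gaussMap_mem hx hi j).1.1
  obtain ⟨h0, -, h1⟩ := qden_bounds hx hi j
  have hv0 : (0 : ℝ) ≤ (qden x j : ℝ) / qden x (j + 1) :=
    div_nonneg (by exact_mod_cast h0) (by exact_mod_cast h1.le)
  rw [hst]
  simp only [belowGraph, lt_pquot_iff hx hi, lt_mediantCut_iff hl hz hv0 ht0]
  by_cases hb : gaussMap^[j] x < 1 / ((l : ℝ) + 1)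
  · have hlt : l * gaussMap^[j] x ≤ 1 := by
      rw [lt_div_iff₀ (by positivity)] at hb
      nlinarith
    rw [← medTheta_eq hx hi hst hlt]
    by_cases hzz : medTheta x l j ≤ z
    · simp [hzz, not_lt.2 hzz]
    · simp [hzz, not_le.1 hzz]
  · simp only [hb, false_and, if_false, sub_self]

/-- Bounds and limiting distribution for the approximation coefficients of the `λ`-th
mediant convergents `(λ p_j + p_{j−1})/(λ q_j + q_{j−1})`, `a_{j+1} > λ`. -/
theorem stmt_7 (l : ℕ) (hl : 1 ≤ l) :
    (∀ x : ℝ, x ∈ Set.Ioo (0:ℝ) 1 → Irrational x → ∀ j : ℕ, (l : ℤ) < pquot x j →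
        (l : ℝ) / ((l:ℝ) + 1) < medTheta x (l : ℤ) j ∧ medTheta x (l : ℤ) j < (l:ℝ) + 1) ∧
    ∀ᵐ x ∂(volume : Measure ℝ), x ∈ Set.Ioo (0:ℝ) 1 → Irrational x →
      {j : ℕ | (l : ℤ) < pquot x j}.Infinite ∧
      ∀ z : ℝ, (l:ℝ) / ((l:ℝ) + 1) ≤ z → z ≤ (l:ℝ) + 1 →
        Tendsto (fun n : ℕ =>
            (((Finset.range n).filter fun k =>
                medTheta x (l : ℤ) (Nat.nth (fun j => (l : ℤ) < pquot x j) k) ≤ z).card : ℝ)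
              / (n : ℝ))
          atTop (𝓝 (dist7 l z)) := by
  refine ⟨fun x hx hi j hj => medTheta_bounds hl hx hi hj, ?_⟩
  have hb : (0 : ℝ) ≤ 1 / ((l : ℝ) + 1) ∧ 1 / ((l : ℝ) + 1) ≤ 1 := by
    refine ⟨by positivity, ?_⟩
    rw [div_le_one (by positivity)]
    linarith [(Nat.cast_nonneg l : (0 : ℝ) ≤ l)]
  have hbLip : BddLip (fun _ => 1 / ((l : ℝ) + 1)) 1 0 :=
    ⟨fun v _ => by rw [abs_of_nonneg hb.1]; exact hb.2, fun v _ w _ => by simp⟩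
  have hA := ae_tendsto_belowGraph_average hbLip measurable_const fun v _ => hb
  have hB : ∀ᵐ x ∂(volume.restrict (Set.Ioo (0 : ℝ) 1)), ∀ r : ℚ, (0 : ℝ) < r →
      Tendsto (fun n : ℕ => (∑ k ∈ Finset.range n,
        belowGraph (mediantCut l r) (gaussNatExt^[k] (0, x))) / n)
        atTop (𝓝 (gaussMean (belowProb (mediantCut l r)))) := by
    refine ae_all_iff.2 fun r => ?_
    by_cases hr : (0 : ℝ) < r
    · filter_upwards [ae_tendsto_belowGraph_average (bddLip_mediantCut hl hr)
        (measurable_mediantCut l r) fun v _ => mediantCut_mem l r v] with x hx _ using hx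
    · exact Eventually.of_forall fun x h => absurd h hr
  filter_upwards [(ae_restrict_iff' measurableSet_Ioo).1 (hA.and hB)] with x hAB hx hi
  obtain ⟨hAx, hBx⟩ := hAB hx
  have hlog2 : 0 < Real.log 2 := Real.log_pos one_lt_two
  have hC : 0 < Real.log (((l : ℝ) + 2) / (l + 1)) := by
    refine Real.log_pos ?_
    rw [one_lt_div (by positivity)]
    linarith
  set α := gaussMean (belowProb fun _ => 1 / ((l : ℝ) + 1)) with hα
  have hαC := gaussMean_belowProb_const l
  have hα0 : 0 < α := by rw [hα, hαC]; positivity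
  have hJ : Tendsto (fun n : ℕ =>
      (((Finset.range n).filter fun j => (l : ℤ) < pquot x j).card : ℝ) / n) atTop (𝓝 α) := by
    simpa only [card_filter_lt_pquot hx hi] using hAx
  refine ⟨infinite_of_tendsto_card_div hα0 hJ, fun z hz hz' => ?_⟩
  have hz0 : 0 < z := lt_of_lt_of_le (by positivity) hz
  have hdist : dist7 l z = (α - gaussMean (belowProb (mediantCut l z))) / α := by
    rw [gaussMean_belowProb_mediantCut hl hz hz', hα, hαC]
    field_simp
    ring
  rw [hdist]
  refine tendsto_of_tendsto_rat_of_monotone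
    (F := fun n w => (((Finset.range n).filter fun k =>
      medTheta x (l : ℤ) (Nat.nth (fun j => (l : ℤ) < pquot x j) k) ≤ w).card : ℝ) / n)
    (G := fun w => (α - gaussMean (belowProb (mediantCut l w))) / α)
    (K := 1 / Real.log 2 / α) (fun n w w' hw => ?_) (fun r hr => ?_) (fun w w' hw hw' => ?_) hz0
  · dsimp only
    gcongr with k hk
  · have hr' : (0 : ℝ) < r := by exact_mod_cast hr
    refine tendsto_card_filter_nth_div (s := fun j => medTheta x l j ≤ r) hα0 hJ ?_
    simpa only [card_filter_medTheta_le hl hx hi hr', sub_div] using hAx.sub (hBx r hr')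
  · rw [← sub_div, sub_sub_sub_cancel_left, abs_div, abs_of_pos hα0, div_mul_eq_mul_div,
      abs_sub_comm]
    gcongr
    exact abs_gaussMean_belowProb_sub_le (bddLip_mediantCut hl hw) (bddLip_mediantCut hl hw')
      (fun v _ => (mediantCut_mem l w v).1) (fun v _ => (mediantCut_mem l w' v).1)
      fun v hv => abs_mediantCut_sub_le hl hw hw' hv.1
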